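/- arXiv:1804.08512 — 4 statements merged into one kernel-verified Lean document; each statement's English description precedes it below -/
import Mathlib

section
/- Let G ∈ H^∞_{m×p} with T_G T_G* strictly positive. Then the function Y(z) = I_p − z E_p*(I − z S_p*)⁻¹ T_G*(T_G T_G*)⁻¹ H_G E_p is analytic on 𝔻, the matrix Y(z) is invertible for every z ∈ 𝔻, and Y(z)⁻¹ = I_p + z E_p* T_G* (T_G T_G*)⁻¹ H_G (I − z S_p)⁻¹ E_p for every z ∈ 𝔻; in particular z ↦ Y(z)⁻¹ is analytic on 𝔻. -/
/-!
Setting: `l2 n` models ℓ²₊(ℂⁿ); `lp.single 2 0` is the canonical embedding `E_n`, and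
evaluating a sequence at coordinate `k` realizes `E_n* (S_n*)^k`.  Block Toeplitz and
Hankel operators, as well as the (bounded) inverse of `T_G T_G*`, are specified through
their actions on the standard basis vectors of the coordinate spaces.
-/

noncomputable section
open scoped Matrix

/-- ℂⁿ with the Euclidean norm. -/
abbrev ES (n : ℕ) : Type := EuclideanSpace ℂ (Fin n)

/-- ℓ²₊(ℂⁿ). -/
abbrev l2 (n : ℕ) : Type := lp (fun _ : ℕ => ES n) 2

/-- The `b`-th standard basis vector of ℂⁿ. -/
abbrev eVec (n : ℕ) (b : Fin n) : ES n := EuclideanSpace.single b 1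

/-- The matrix function `z ↦ ∑' ν, z ^ ν • F ν` determined by a coefficient sequence. -/
def seriesM {r s : ℕ} (F : ℕ → Matrix (Fin r) (Fin s) ℂ) (z : ℂ) :
    Matrix (Fin r) (Fin s) ℂ :=
  Matrix.of fun a b => ∑' ν : ℕ, z ^ ν * F ν a b

theorem memℓp_comp_succ {n : ℕ} (x : l2 n) :
    Memℓp (E := fun _ : ℕ => ES n) (fun i => x (i + 1)) 2 :=
  memℓp_gen (((lp.memℓp x).summable (by norm_num)).comp_injective (add_left_injective 1))

/-- The backward shift on ℓ²₊(ℂⁿ). -/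
def backwardShift (n : ℕ) : l2 n →L[ℂ] l2 n :=
  LinearMap.mkContinuous
    { toFun := fun x => ⟨fun i => x (i + 1), memℓp_comp_succ x⟩
      map_add' := fun _ _ => rfl
      map_smul' := fun _ _ => rfl } 1 (fun x => by
    have h2 : (0 : ℝ) < (2 : ENNReal).toReal := by norm_num
    rw [one_mul]
    refine lp.norm_le_of_tsum_le h2 (norm_nonneg x) ?_
    rw [lp.norm_rpow_eq_tsum h2 x]
    exact tsum_comp_le_tsum_of_inj ((lp.memℓp x).summable h2)
      (fun _ => Real.rpow_nonneg (norm_nonneg _) _) (add_left_injective 1))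

theorem backwardShift_apply {n : ℕ} (x : l2 n) (i : ℕ) : backwardShift n x i = x (i + 1) := rfl

/-- The forward shift on ℓ²₊(ℂⁿ). -/
def forwardShift (n : ℕ) : l2 n →L[ℂ] l2 n := (backwardShift n).adjoint

theorem backwardShift_single_zero {n : ℕ} (v : ES n) :
    backwardShift n (lp.single 2 0 v) = 0 := by
  ext i : 2
  rw [backwardShift_apply]
  exact lp.single_apply_ne _ _ _ (Nat.succ_ne_zero i)

theorem backwardShift_single_succ {n : ℕ} (j : ℕ) (v : ES n) :
    backwardShift n (lp.single 2 (j + 1) v) = lp.single 2 j v := by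
  ext i : 2
  rw [backwardShift_apply, lp.single_apply, lp.single_apply, Pi.single_apply, Pi.single_apply]
  simp

theorem inner_forwardShift_apply {n : ℕ} (x : l2 n) (i : ℕ) (v : ES n) :
    inner ℂ v (forwardShift n x i) = inner ℂ (backwardShift n (lp.single 2 i v)) x := by
  have h := lp.inner_single_left (𝕜 := ℂ) (G := fun _ : ℕ => ES n) i v (forwardShift n x)
  rw [← h]
  exact ContinuousLinearMap.adjoint_inner_right (backwardShift n) _ _

theorem forwardShift_apply_zero {n : ℕ} (x : l2 n) : forwardShift n x 0 = 0 := by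
  refine ext_inner_left ℂ fun v => ?_
  rw [inner_forwardShift_apply, backwardShift_single_zero, inner_zero_left, inner_zero_right]

theorem forwardShift_apply_succ {n : ℕ} (x : l2 n) (i : ℕ) :
    forwardShift n x (i + 1) = x i := by
  refine ext_inner_left ℂ fun v => ?_
  rw [inner_forwardShift_apply, backwardShift_single_succ, lp.inner_single_left]

theorem forwardShift_single {n : ℕ} (j : ℕ) (v : ES n) :
    forwardShift n (lp.single 2 j v) = lp.single 2 (j + 1) v := by
  ext i : 2
  cases i with
  | zero =>
    rw [forwardShift_apply_zero]
    exact (lp.single_apply_ne (E := fun _ : ℕ => ES n) 2 _ v (Nat.succ_ne_zero j).symm).symm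
  | succ i =>
    rw [forwardShift_apply_succ, lp.single_apply, lp.single_apply, Pi.single_apply,
      Pi.single_apply]
    simp

theorem eq_sum_eVec {n : ℕ} (v : ES n) : v = ∑ b, v b • eVec n b := by
  ext a
  simp [Pi.single_apply]

theorem single_eq_sum {n : ℕ} (j : ℕ) (v : ES n) :
    (lp.single 2 j v : l2 n) = ∑ b, v b • lp.single 2 j (eVec n b) := by
  conv_lhs => rw [eq_sum_eVec v]
  change lp.singleAddMonoidHom (E := fun _ : ℕ => ES n) 2 j _ = _
  rw [map_sum]
  exact Finset.sum_congr rfl fun b _ => lp.single_smul _ _ _ _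

theorem clm_ext_single {n k : ℕ} {A B : l2 n →L[ℂ] l2 k}
    (h : ∀ j b, A (lp.single 2 j (eVec n b)) = B (lp.single 2 j (eVec n b))) : A = B := by
  ext1 x
  have hx := lp.hasSum_single (p := 2) (by norm_num) x
  refine (hx.mapL A).unique ?_
  convert! hx.mapL B using 2 with j
  rw [single_eq_sum, map_sum, map_sum]
  exact Finset.sum_congr rfl fun b _ => by rw [map_smul, map_smul, h]

theorem forwardShift_backwardShift {n : ℕ} (x : l2 n) :
    forwardShift n (backwardShift n x) = x - lp.single 2 0 (x 0) := by
  ext i : 2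
  cases i with
  | zero =>
    rw [forwardShift_apply_zero, lp.coeFn_sub, Pi.sub_apply, lp.single_apply_self, sub_self]
  | succ i =>
    rw [forwardShift_apply_succ, backwardShift_apply, lp.coeFn_sub, Pi.sub_apply,
      lp.single_apply_ne _ _ _ (Nat.succ_ne_zero i), sub_zero]

section Toeplitz

variable {m p : ℕ} {G : ℕ → Matrix (Fin m) (Fin p) ℂ} {TG HG : l2 p →L[ℂ] l2 m}

theorem toeplitz_forwardShift
    (hTG : ∀ (j : ℕ) (b : Fin p) (i : ℕ) (a : Fin m),
      (TG (lp.single 2 j (eVec p b))) i a = if j ≤ i then G (i - j) a b else 0) :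
    TG ∘L forwardShift p = forwardShift m ∘L TG := by
  refine clm_ext_single fun j b => ?_
  ext i a
  rw [ContinuousLinearMap.comp_apply, ContinuousLinearMap.comp_apply, forwardShift_single, hTG]
  cases i with
  | zero => simp [forwardShift_apply_zero]
  | succ i => simp [forwardShift_apply_succ, hTG]

theorem hankel_forwardShift
    (hHG : ∀ (j : ℕ) (b : Fin p) (i : ℕ) (a : Fin m),
      (HG (lp.single 2 j (eVec p b))) i a = G (i + j + 1) a b) :
    HG ∘L forwardShift p = backwardShift m ∘L HG := by
  refine clm_ext_single fun j b => ?_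
  ext i a
  rw [ContinuousLinearMap.comp_apply, ContinuousLinearMap.comp_apply, forwardShift_single, hHG,
    backwardShift_apply, hHG]
  congr 2
  ring

theorem backwardShift_toeplitz
    (hTG : ∀ (j : ℕ) (b : Fin p) (i : ℕ) (a : Fin m),
      (TG (lp.single 2 j (eVec p b))) i a = if j ≤ i then G (i - j) a b else 0)
    (hHG : ∀ (j : ℕ) (b : Fin p) (i : ℕ) (a : Fin m),
      (HG (lp.single 2 j (eVec p b))) i a = G (i + j + 1) a b) :
    backwardShift m ∘L TG = TG ∘L backwardShift p +
      HG ∘L (ContinuousLinearMap.id ℂ (l2 p) - forwardShift p ∘L backwardShift p) := by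
  refine clm_ext_single fun j b => ?_
  ext i a
  simp only [ContinuousLinearMap.comp_apply, add_apply,
    sub_apply, ContinuousLinearMap.id_apply, backwardShift_apply, hTG]
  cases j with
  | zero => simp [backwardShift_single_zero, hHG]
  | succ j => simp [backwardShift_single_succ, forwardShift_single, hTG]

/-- The operator `A = T_G* (T_G T_G*)⁻¹ H_G` satisfies `S* A = A S - A E E* A`. -/
theorem backwardShift_toeplitz_adjoint_hankel
    (hTG : ∀ (j : ℕ) (b : Fin p) (i : ℕ) (a : Fin m),
      (TG (lp.single 2 j (eVec p b))) i a = if j ≤ i then G (i - j) a b else 0)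
    (hHG : ∀ (j : ℕ) (b : Fin p) (i : ℕ) (a : Fin m),
      (HG (lp.single 2 j (eVec p b))) i a = G (i + j + 1) a b)
    (Tinv : l2 m →L[ℂ] l2 m)
    (hT1 : ∀ x, Tinv (TG (TG.adjoint x)) = x) (hT2 : ∀ x, TG (TG.adjoint (Tinv x)) = x)
    {A : l2 p →L[ℂ] l2 p} (hA : A = TG.adjoint ∘L Tinv ∘L HG) (x : l2 p) :
    backwardShift p (A x) = A (forwardShift p x) - A (lp.single 2 0 (A x 0)) := by
  have hadj (y : l2 m) : backwardShift p (TG.adjoint y) = TG.adjoint (backwardShift m y) := by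
    have h := congrArg ContinuousLinearMap.adjoint (toeplitz_forwardShift hTG)
    simp only [ContinuousLinearMap.adjoint_comp, forwardShift,
      ContinuousLinearMap.adjoint_adjoint] at h
    exact DFunLike.congr_fun h y
  have hA' (y : l2 p) : A y = TG.adjoint (Tinv (HG y)) := by rw [hA]; rfl
  have hproj : backwardShift p (A x) = TG.adjoint (Tinv (TG (backwardShift p (A x)))) := by
    rw [hA', hadj, hT1]
  have hBT := DFunLike.congr_fun (backwardShift_toeplitz hTG hHG) (A x)
  have hHS := DFunLike.congr_fun (hankel_forwardShift hHG) x
  simp only [ContinuousLinearMap.comp_apply, add_apply,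
    sub_apply, ContinuousLinearMap.id_apply,
    forwardShift_backwardShift, sub_sub_cancel] at hBT hHS
  rw [hA' x, hT2, ← hA' x, ← hHS] at hBT
  rw [hproj, hA' (forwardShift p x), hA' (lp.single 2 0 (A x 0)), hBT, map_add, map_add,
    add_sub_cancel_right]

end Toeplitz

section PowerSeries

theorem summable_pow_mul_of_bounded {c : ℕ → ℂ} {C : ℝ} (hc : ∀ i, ‖c i‖ ≤ C) {z : ℂ}
    (hz : ‖z‖ < 1) : Summable fun i => z ^ i * c i := by
  refine Summable.of_norm_bounded
    ((summable_geometric_of_lt_one (norm_nonneg z) hz).mul_right C) fun i => ?_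
  rw [norm_mul, norm_pow]
  gcongr
  exact hc i

theorem analyticOnNhd_tsum_pow_mul {c : ℕ → ℂ} {C : ℝ} (hc : ∀ i, ‖c i‖ ≤ C) :
    AnalyticOnNhd ℂ (fun z => ∑' i, z ^ i * c i) (Metric.ball 0 1) := by
  intro z hz
  obtain ⟨r, hzr, hr⟩ := exists_between (mem_ball_zero_iff.mp hz)
  have hr0 : 0 ≤ r := (norm_nonneg z).trans hzr.le
  refine DifferentiableOn.analyticOnNhd (s := Metric.ball 0 r) ?_ Metric.isOpen_ball z
    (mem_ball_zero_iff.mpr hzr)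
  refine Complex.differentiableOn_tsum_of_summable_norm
    ((summable_geometric_of_lt_one hr0 hr).mul_right C) (fun i => by fun_prop)
    Metric.isOpen_ball fun i w hw => ?_
  have hw' := (mem_ball_zero_iff.mp hw).le
  rw [norm_mul, norm_pow]
  gcongr
  exact hc i

theorem norm_coord_le {n : ℕ} (x : l2 n) (i : ℕ) (a : Fin n) : ‖x i a‖ ≤ ‖x‖ :=
  (PiLp.norm_apply_le (x i) a).trans (lp.norm_apply_le_norm two_ne_zero x i)

/-- The functional `x ↦ ∑ i, z ^ i * x i a`, that is, `e_a* E* (I - z S*)⁻¹`. -/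
def resolventCoord {n : ℕ} {z : ℂ} (hz : ‖z‖ < 1) (a : Fin n) : l2 n →ₗ[ℂ] ℂ where
  toFun x := ∑' i, z ^ i * x i a
  map_add' x y := by
    rw [← Summable.tsum_add (summable_pow_mul_of_bounded (norm_coord_le x · a) hz)
      (summable_pow_mul_of_bounded (norm_coord_le y · a) hz)]
    exact tsum_congr fun i => mul_add _ _ _
  map_smul' c x := by
    rw [RingHom.id_apply, smul_eq_mul, ← tsum_mul_left]
    exact tsum_congr fun i => mul_left_comm _ _ _

theorem resolventCoord_backwardShift {n : ℕ} {z : ℂ} (hz : ‖z‖ < 1) (a : Fin n) (x : l2 n) :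
    z * resolventCoord hz a (backwardShift n x) = resolventCoord hz a x - x 0 a := by
  change z * ∑' i, z ^ i * x (i + 1) a = (∑' i, z ^ i * x i a) - x 0 a
  rw [(summable_pow_mul_of_bounded (norm_coord_le x · a) hz).tsum_eq_zero_add, ← tsum_mul_left,
    pow_zero, one_mul, add_sub_cancel_left]
  exact tsum_congr fun i => by ring

theorem summable_pow_smul_single {n : ℕ} {z : ℂ} (hz : ‖z‖ < 1) (v : ES n) :
    Summable fun i : ℕ => z ^ i • (lp.single 2 i v : l2 n) := by
  refine Summable.of_norm_bounded
    ((summable_geometric_of_lt_one (norm_nonneg z) hz).mul_right ‖v‖) fun i => ?_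
  rw [norm_smul, norm_pow, lp.norm_single (by norm_num)]

theorem tsum_pow_smul_single_eq {n : ℕ} {z : ℂ} (hz : ‖z‖ < 1) (v : ES n) :
    ∑' i : ℕ, z ^ i • (lp.single 2 i v : l2 n) =
      lp.single 2 0 v + z • forwardShift n (∑' i : ℕ, z ^ i • lp.single 2 i v) := by
  have hs := summable_pow_smul_single hz v
  rw [(forwardShift n).map_tsum hs, ← tsum_const_smul'' z, hs.tsum_eq_zero_add, pow_zero,
    one_smul]
  congr 1
  exact tsum_congr fun i => by rw [map_smul, forwardShift_single, smul_smul, pow_succ']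

/-- The coordinate functional `x ↦ x 0 a`. -/
def zeroCoord {n : ℕ} (a : Fin n) : l2 n →L[ℂ] ℂ :=
  EuclideanSpace.proj a ∘L lp.evalCLM ℂ (fun _ : ℕ => ES n) 2 0

theorem analyticOnNhd_apply_tsum_pow_smul_single {n : ℕ} (f : l2 n →L[ℂ] ℂ) (v : ES n) :
    AnalyticOnNhd ℂ (fun z : ℂ => f (∑' i : ℕ, z ^ i • lp.single 2 i v)) (Metric.ball 0 1) := by
  refine AnalyticOnNhd.congr (f := fun z => ∑' i : ℕ, z ^ i * f (lp.single 2 i v))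
    Metric.isOpen_ball (analyticOnNhd_tsum_pow_mul (c := fun i : ℕ => f (lp.single 2 i v))
      (C := ‖f‖ * ‖v‖) fun i => ?_) fun z hz => ?_
  · refine (f.le_opNorm _).trans_eq ?_
    rw [lp.norm_single (by norm_num)]
  · simp only [f.map_tsum (summable_pow_smul_single (mem_ball_zero_iff.mp hz) v), map_smul,
      smul_eq_mul]

end PowerSeries

/-- If `S* A = A S - A E E* A`, then
`(I - z E* (I - z S*)⁻¹ A E) (I + z E* A (I - z S)⁻¹ E) = I`. -/
theorem mul_eq_one_of_backwardShift_comp {p : ℕ} {A : l2 p →L[ℂ] l2 p}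
    (hA : ∀ x, backwardShift p (A x) = A (forwardShift p x) - A (lp.single 2 0 (A x 0)))
    {z : ℂ} (hz : ‖z‖ < 1) :
    (Matrix.of fun a b : Fin p => (if a = b then 1 else 0)
        - z * resolventCoord hz a (A (lp.single 2 0 (eVec p b)))) *
      (Matrix.of fun a b : Fin p => (if a = b then 1 else 0)
        + z * (A (∑' i : ℕ, z ^ i • lp.single 2 i (eVec p b))) 0 a) = 1 := by
  ext a c
  set K : l2 p := ∑' i : ℕ, z ^ i • lp.single 2 i (eVec p c) with hK
  have hsum : ∑ b, resolventCoord hz a (A (lp.single 2 0 (eVec p b))) * A K 0 b =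
      resolventCoord hz a (A (lp.single 2 0 (A K 0))) := by
    rw [single_eq_sum 0 (A K 0)]
    simp only [map_sum, map_smul, smul_eq_mul]
    exact Finset.sum_congr rfl fun b _ => mul_comm _ _
  have hR := congrArg (resolventCoord hz a) (hA K)
  rw [map_sub] at hR
  have hB := resolventCoord_backwardShift hz a (A K)
  have hKS := congrArg (fun x => resolventCoord hz a (A x)) (tsum_pow_smul_single_eq hz (eVec p c))
  simp only [← hK, map_add, map_smul, smul_eq_mul] at hKS
  simp only [Matrix.mul_apply, Matrix.of_apply, Matrix.one_apply, sub_mul, mul_add,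
    Finset.sum_sub_distrib, Finset.sum_add_distrib, ite_mul, mul_ite, one_mul, zero_mul, mul_one,
    mul_zero, Finset.sum_ite_eq, Finset.sum_ite_eq', Finset.mem_univ, if_true]
  have hz2 : ∑ b, z * resolventCoord hz a (A (lp.single 2 0 (eVec p b))) * (z * A K 0 b) =
      z * z * resolventCoord hz a (A (lp.single 2 0 (A K 0))) := by
    rw [← hsum, Finset.mul_sum]
    exact Finset.sum_congr rfl fun b _ => by ring
  rw [hz2]
  linear_combination z * hKS - z * z * hR + z * hB

/-- For `G ∈ H^∞_{m×p}` with `T_G T_G*` strictly positive, the function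
`Y(z) = I_p − z E_p*(I − z S_p*)⁻¹ T_G*(T_G T_G*)⁻¹ H_G E_p` is analytic on 𝔻 (entrywise),
`Y(z)` is invertible for every `z ∈ 𝔻`, and
`Y(z)⁻¹ = I_p + z E_p* T_G* (T_G T_G*)⁻¹ H_G (I − z S_p)⁻¹ E_p`; in particular
`z ↦ Y(z)⁻¹` is analytic on 𝔻. -/
theorem bezout_corona_stmt2
    (m p : ℕ) (hm : 0 < m) (hmp : m ≤ p)
    (G : ℕ → Matrix (Fin m) (Fin p) ℂ)
    (TG : l2 p →L[ℂ] l2 m)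
    (hTG : ∀ (j : ℕ) (b : Fin p) (i : ℕ) (a : Fin m),
      (TG (lp.single 2 j (eVec p b))) i a = if j ≤ i then G (i - j) a b else 0)
    (HG : l2 p →L[ℂ] l2 m)
    (hHG : ∀ (j : ℕ) (b : Fin p) (i : ℕ) (a : Fin m),
      (HG (lp.single 2 j (eVec p b))) i a = G (i + j + 1) a b)
    (Tinv : l2 m →L[ℂ] l2 m)
    (hT1 : ∀ x, Tinv (TG (TG.adjoint x)) = x)
    (hT2 : ∀ x, TG (TG.adjoint (Tinv x)) = x)
    (Y : ℂ → Matrix (Fin p) (Fin p) ℂ)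
    (hY : ∀ z ∈ Metric.ball (0 : ℂ) 1, ∀ (a b : Fin p),
      Y z a b = (if a = b then 1 else 0)
        - z * ∑' i : ℕ, z ^ i *
            (TG.adjoint (Tinv (HG (lp.single 2 0 (eVec p b))))) i a) :
    (∀ a b : Fin p, AnalyticOnNhd ℂ (fun z => Y z a b) (Metric.ball 0 1)) ∧
    (∀ z ∈ Metric.ball (0 : ℂ) 1, IsUnit (Y z)) ∧
    (∀ z ∈ Metric.ball (0 : ℂ) 1, ∀ a b : Fin p,
      (Y z)⁻¹ a b = (if a = b then 1 else 0)
        + z * (TG.adjoint (Tinv (HG (∑' i : ℕ, z ^ i • lp.single 2 i (eVec p b))))) 0 a) ∧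
    (∀ a b : Fin p, AnalyticOnNhd ℂ (fun z => (Y z)⁻¹ a b) (Metric.ball 0 1)) := by
  set A : l2 p →L[ℂ] l2 p := TG.adjoint ∘L Tinv ∘L HG with hA
  have hric := backwardShift_toeplitz_adjoint_hankel hTG hHG Tinv hT1 hT2 hA
  set X : ℂ → Matrix (Fin p) (Fin p) ℂ := fun z => Matrix.of fun a b =>
    (if a = b then 1 else 0) + z * (A (∑' i : ℕ, z ^ i • lp.single 2 i (eVec p b))) 0 a
  have hYX : ∀ z ∈ Metric.ball (0 : ℂ) 1, Y z * X z = 1 := fun z hz => by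
    rw [← mul_eq_one_of_backwardShift_comp hric (mem_ball_zero_iff.mp hz)]
    congr 1
    ext a b
    exact hY z hz a b
  have hinv : ∀ z ∈ Metric.ball (0 : ℂ) 1, (Y z)⁻¹ = X z := fun z hz =>
    Matrix.inv_eq_right_inv (hYX z hz)
  refine ⟨fun a b => ?_, fun z hz => IsUnit.of_mul_eq_one _ (hYX z hz), fun z hz a b => ?_,
    fun a b => ?_⟩
  · refine AnalyticOnNhd.congr Metric.isOpen_ball (analyticOnNhd_const.sub (analyticOnNhd_id.mul
      (analyticOnNhd_tsum_pow_mul (norm_coord_le (A (lp.single 2 0 (eVec p b))) · a))))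
      fun z hz => (hY z hz a b).symm
  · rw [hinv z hz]
    rfl
  · refine AnalyticOnNhd.congr (f := fun z => X z a b) Metric.isOpen_ball
      (analyticOnNhd_const.add (analyticOnNhd_id.mul
      (analyticOnNhd_apply_tsum_pow_smul_single (zeroCoord a ∘L A) (eVec p b))))
      fun z hz => ?_
    simp only [hinv z hz]
end
end

section
/- Let G ∈ H^∞_{m×p} with T_G T_G* strictly positive, and let θ(z) = Y(z)Θ₀. Then θ belongs to H^∞_{p×(p−m)}, θ is inner (its block Toeplitz operator T_θ : ℓ²₊(ℂ^{p−m}) → ℓ²₊(ℂᵖ) is an isometry), and the range of T_θ equals the kernel of T_G. -/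
/-!
Setting: `l2 n` models ℓ²₊(ℂⁿ); `lp.single 2 0` is the canonical embedding `E_n`, and
evaluating a sequence at coordinate `k` realizes `E_n* (S_n*)^k`.  Block Toeplitz and
Hankel operators, as well as the (bounded) inverse of `T_G T_G*`, are specified through
their actions on the standard basis vectors of the coordinate spaces.
-/

noncomputable section
open scoped Matrix

open scoped InnerProductSpace

namespace BlockShift

variable {n : ℕ}

/-- The forward shift on `ℓ²₊(ℂⁿ)`. -/
def shift (n : ℕ) : l2 n →ₗᵢ[ℂ] l2 n where
  toFun x := ⟨fun i => Nat.casesOn i 0 fun k => x k, memℓp_gen <| by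
    rw [← summable_nat_add_iff 1]
    exact (lp.memℓp x).summable (by norm_num)⟩
  map_add' x y := by
    ext i : 2
    cases i with
    | zero => exact (add_zero (0 : ES n)).symm
    | succ i => rfl
  map_smul' c x := by
    ext i : 2
    cases i with
    | zero => exact (smul_zero c).symm
    | succ i => rfl
  norm_map' x := by
    have h2 : 0 < (2 : ENNReal).toReal := by norm_num
    rw [lp.norm_eq_tsum_rpow h2, lp.norm_eq_tsum_rpow h2, Summable.tsum_eq_zero_add]
    · change (‖(0 : ES n)‖ ^ _ + ∑' k, ‖x k‖ ^ _) ^ _ = _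
      rw [norm_zero, Real.zero_rpow h2.ne', zero_add]
    · exact (lp.memℓp _).summable h2

@[simp]
theorem shift_apply_zero (x : l2 n) : shift n x 0 = 0 := rfl

@[simp]
theorem shift_apply_succ (x : l2 n) (i : ℕ) : shift n x (i + 1) = x i := rfl

theorem exists_shift_eq {x : l2 n} (hx : x 0 = 0) : ∃ y, shift n y = x := by
  refine ⟨⟨fun i => x (i + 1), memℓp_gen ?_⟩, ?_⟩
  · exact (summable_nat_add_iff 1).2 ((lp.memℓp x).summable (by norm_num))
  · ext i : 2
    cases i with
    | zero => exact hx.symm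
    | succ i => rfl

/-- The embedding of `ℂⁿ` onto the zeroth coordinate, as a linear map. -/
abbrev embedZero (n : ℕ) : ES n →ₗ[ℂ] l2 n :=
  lp.lsingle (𝕜 := ℂ) (E := fun _ : ℕ => ES n) 2 0

@[simp]
theorem shift_single (j : ℕ) (v : ES n) :
    shift n (lp.single 2 j v) = lp.single 2 (j + 1) v := by
  ext i : 2
  cases i with
  | zero => simp [lp.single_apply]
  | succ i => simp [lp.single_apply, Pi.single_apply]

theorem shift_pow_succ_apply (j : ℕ) (x : l2 n) :
    (shift n ^ (j + 1)) x = shift n ((shift n ^ j) x) := by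
  rw [pow_succ']; rfl

theorem shift_pow_apply (j : ℕ) (x : l2 n) (i : ℕ) :
    (shift n ^ j) x i = if j ≤ i then x (i - j) else 0 := by
  induction j generalizing i with
  | zero => simp
  | succ j ih =>
    rw [shift_pow_succ_apply]
    cases i with
    | zero => simp
    | succ i => simp [ih]

theorem inner_single_zero_shift (v : ES n) (x : l2 n) :
    ⟪(lp.single 2 0 v : l2 n), shift n x⟫_ℂ = 0 := by
  rw [lp.inner_single_left, shift_apply_zero, inner_zero_right]

theorem ext_single {F : Type*} [AddCommGroup F] [Module ℂ F] [TopologicalSpace F] [T2Space F]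
    {f g : l2 n →L[ℂ] F}
    (h : ∀ j b, f (lp.single 2 j (eVec n b)) = g (lp.single 2 j (eVec n b))) : f = g := by
  refine lp.ext_continuousLinearMap (by norm_num) fun j => ?_
  refine ContinuousLinearMap.coe_injective ?_
  refine (EuclideanSpace.basisFun (Fin n) ℂ).toBasis.ext fun b => ?_
  simpa using h j b

/-- Wold decomposition of a closed subspace `K` that is invariant under the shift and under
removing an initial zero: an isometry `V` onto a wandering subspace of `K` induces an isometry
on `ℓ²₊` with range `K`. -/
theorem exists_isometry_range_eq {F : Type*} [NormedAddCommGroup F] [InnerProductSpace ℂ F]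
    [CompleteSpace F] (K : Submodule ℂ (l2 n)) (hK : ∀ x, shift n x ∈ K ↔ x ∈ K)
    (V : F →ₗᵢ[ℂ] l2 n) (hVK : ∀ w, V w ∈ K)
    (hV : ∀ w, ∀ k ∈ K, ⟪V w, shift n k⟫_ℂ = 0)
    (hV0 : ∀ k ∈ K, (∀ w, ⟪V w, k⟫_ℂ = 0) → k 0 = 0)
    (hKc : IsClosed (K : Set (l2 n))) :
    ∃ T : lp (fun _ : ℕ => F) 2 →ₗᵢ[ℂ] l2 n,
      (∀ j w, T (lp.single 2 j w) = (shift n ^ j) (V w)) ∧ Set.range T = K := by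
  have hpow : ∀ (j : ℕ) (x : l2 n), x ∈ K → (shift n ^ j) x ∈ K := by
    intro j x hx
    induction j with
    | zero => exact hx
    | succ j ih => rw [shift_pow_succ_apply]; exact (hK _).2 ih
  have hlt : ∀ i d : ℕ, ∀ v w, ⟪(shift n ^ i) (V v), (shift n ^ (i + (d + 1))) (V w)⟫_ℂ = 0 := by
    intro i d v w
    rw [pow_add, LinearIsometry.coe_mul, Function.comp_apply, LinearIsometry.inner_map_map,
      shift_pow_succ_apply]
    exact hV _ _ (hpow _ _ (hVK _))
  have horth : OrthogonalFamily ℂ (fun _ : ℕ => F) fun j => (shift n ^ j).comp V := by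
    intro i j hij v w
    rcases lt_or_gt_of_ne hij with h | h
    · obtain ⟨d, rfl⟩ := Nat.exists_eq_add_of_lt h
      exact hlt i d v w
    · obtain ⟨d, rfl⟩ := Nat.exists_eq_add_of_lt h
      exact inner_eq_zero_symm.1 (hlt j d w v)
  have hsingle : ∀ j w, horth.linearIsometry (lp.single 2 j w) = (shift n ^ j) (V w) :=
    fun j w => horth.linearIsometry_apply_single w
  refine ⟨horth.linearIsometry, hsingle, ?_⟩
  have hcoord : ∀ i, ∀ k ∈ K, (∀ j w, ⟪(shift n ^ j) (V w), k⟫_ℂ = 0) → k i = 0 := by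
    intro i
    induction i with
    | zero => exact fun k hk h => hV0 k hk fun w => h 0 w
    | succ i ih =>
      intro k hk h
      obtain ⟨y, rfl⟩ := exists_shift_eq (hV0 k hk fun w => h 0 w)
      refine ih y ((hK y).1 hk) fun j w => ?_
      have := h (j + 1) w
      rwa [shift_pow_succ_apply, LinearIsometry.inner_map_map] at this
  have hle : ∀ f, horth.linearIsometry f ∈ K := fun f =>
    hKc.mem_of_tendsto (horth.hasSum_linearIsometry f)
      (Filter.Eventually.of_forall fun s => K.sum_mem fun i _ => hpow _ _ (hVK _))
  refine Set.Subset.antisymm (Set.range_subset_iff.2 hle) fun x hx => ?_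
  let T := horth.linearIsometry
  let R := LinearMap.range T.toLinearMap
  have : CompleteSpace R := T.isometry.isUniformInducing.isComplete_range.completeSpace_coe
  obtain ⟨_, ⟨f, rfl⟩, z, hz, rfl⟩ := R.exists_add_mem_mem_orthogonal x
  have hzK : z ∈ K := (K.add_mem_iff_right (hle f)).1 hx
  have hz0 : z = 0 := by
    ext i : 2
    refine hcoord i z hzK fun j w => ?_
    rw [← hsingle j w]
    exact (Submodule.mem_orthogonal _ _).1 hz _ ⟨_, rfl⟩
  exact ⟨f, by rw [hz0, add_zero]; rfl⟩

variable {m p : ℕ}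

/-- If `A` has adjoint `B`, `B` is onto and `A B` is the compression to the zeroth coordinate of
the orthogonal projection onto `ker TG`, then the columns
`E A w - S TG* (TG TG*)⁻¹ HG E A w` generate an isometry with range `ker TG`. -/
theorem exists_isometry_range_eq_ker {F : Type*} [NormedAddCommGroup F] [InnerProductSpace ℂ F]
    [CompleteSpace F] {TG HG : l2 p →L[ℂ] l2 m} {Tinv : l2 m →L[ℂ] l2 m}
    (hS : ∀ x, TG (shift p x) = shift m (TG x))
    (hH : ∀ u i, TG (lp.single 2 0 u) (i + 1) = HG (lp.single 2 0 u) i)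
    (hT : ∀ x, TG (TG.adjoint (Tinv x)) = x)
    (A : F →ₗ[ℂ] ES p) (B : ES p → F) (hAB : ∀ w v, ⟪A w, v⟫_ℂ = ⟪w, B v⟫_ℂ)
    (hB : Function.Surjective B)
    (hABv : ∀ v, A (B v) = v - TG.adjoint (Tinv (TG (lp.single 2 0 v))) 0) :
    ∃ T : lp (fun _ : ℕ => F) 2 →ₗᵢ[ℂ] l2 p,
      (∀ j w, T (lp.single 2 j w) = (shift p ^ j) (lp.single 2 0 (A w) -
        shift p (TG.adjoint (Tinv (HG (lp.single 2 0 (A w))))))) ∧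
      Set.range T = {x | TG x = 0} := by
  have hBA : ∀ v w, ⟪v, A w⟫_ℂ = ⟪B v, w⟫_ℂ := fun v w => by
    rw [← inner_conj_symm, hAB, inner_conj_symm]
  have hTadj : ∀ y k, TG k = 0 → ⟪TG.adjoint y, k⟫_ℂ = 0 := fun y k hk => by
    rw [ContinuousLinearMap.adjoint_inner_left, hk, inner_zero_right]
  have hTk : ∀ x, TG x = 0 ↔ TG (shift p x) = 0 := fun x => by
    rw [hS, map_eq_zero_iff _ (shift m).injective]
  let V₀ : F →ₗ[ℂ] l2 p :=
    embedZero p ∘ₗ A - (shift p).toLinearMap ∘ₗ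
      (TG.adjoint ∘L Tinv ∘L HG).toLinearMap ∘ₗ embedZero p ∘ₗ A
  have hV₀ : ∀ w, V₀ w = lp.single 2 0 (A w) -
      shift p (TG.adjoint (Tinv (HG (lp.single 2 0 (A w))))) := fun _ => rfl
  let P : l2 p → l2 p := fun x => x - TG.adjoint (Tinv (TG x))
  have hP : ∀ x, TG (P x) = 0 := fun x => by rw [map_sub, hT, sub_self]
  have hPinner : ∀ x k, TG k = 0 → ⟪P x, k⟫_ℂ = ⟪x, k⟫_ℂ := fun x k hk => by
    rw [inner_sub_left, hTadj _ _ hk, sub_zero]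
  have hP0 : ∀ v, P (lp.single 2 0 v) 0 = A (B v) := fun v => by
    rw [hABv]
    change (lp.single 2 0 v : l2 p) 0 - _ = _
    rw [lp.single_apply_self]
  have hzero : ∀ x, TG x 0 = TG (lp.single 2 0 (x 0)) 0 := fun x => by
    obtain ⟨y, hy⟩ := exists_shift_eq (x := x - lp.single 2 0 (x 0)) (by
      change x 0 - (lp.single 2 0 (x 0) : l2 p) 0 = 0
      rw [lp.single_apply_self, sub_self])
    rw [← sub_eq_zero]
    change (TG x - TG (lp.single 2 0 (x 0))) 0 = 0
    rw [← map_sub, ← hy, hS, shift_apply_zero]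
  have hA0 : ∀ w, TG (lp.single 2 0 (A w)) 0 = 0 := fun w => by
    obtain ⟨v, rfl⟩ := hB w
    rw [← hP0, ← hzero, hP]
    rfl
  have hVK : ∀ w, TG (V₀ w) = 0 := fun w => by
    rw [hV₀, map_sub, hS, hT, sub_eq_zero]
    ext i : 2
    cases i with
    | zero => rw [hA0, shift_apply_zero]
    | succ i => rw [hH, shift_apply_succ]
  have hV : ∀ w k, TG k = 0 → ⟪V₀ w, shift p k⟫_ℂ = 0 := fun w k hk => by
    rw [hV₀, inner_sub_left, inner_single_zero_shift, LinearIsometry.inner_map_map,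
      hTadj _ _ hk, sub_zero]
  have hVP : ∀ v, V₀ (B v) = P (lp.single 2 0 v) := fun v => by
    have h0 : (V₀ (B v) - P (lp.single 2 0 v)) 0 = 0 := by
      change ((lp.single 2 0 (A (B v)) : l2 p) 0 - 0) - P (lp.single 2 0 v) 0 = 0
      rw [hP0, lp.single_apply_self, sub_zero, sub_self]
    have hker : TG (V₀ (B v) - P (lp.single 2 0 v)) = 0 := by rw [map_sub, hVK, hP, sub_zero]
    obtain ⟨k, hk⟩ := exists_shift_eq h0
    rw [← hk, ← hTk] at hker
    rw [← sub_eq_zero, ← inner_self_eq_zero (𝕜 := ℂ)]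
    nth_rewrite 2 [← hk]
    rw [inner_sub_left, hV _ _ hker, hPinner _ _ ((hTk k).1 hker), inner_single_zero_shift,
      sub_zero]
  let V : F →ₗᵢ[ℂ] l2 p := V₀.isometryOfInner fun w w' => by
    obtain ⟨v, rfl⟩ := hB w
    obtain ⟨v', rfl⟩ := hB w'
    rw [hVP, hVP, hPinner _ _ (hP _), lp.inner_single_left, hP0, hBA]
  obtain ⟨T, hT, hrange⟩ := exists_isometry_range_eq TG.toLinearMap.ker
    (fun x => (hTk x).symm) V hVK hV (fun k hk h => by
      refine (inner_self_eq_zero (𝕜 := ℂ)).1 ?_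
      refine (lp.inner_single_left (𝕜 := ℂ) 0 (k 0) k).symm.trans ?_
      rw [← hPinner _ _ hk, ← hVP]
      exact h _) TG.isClosed_ker
  exact ⟨T, hT, hrange⟩

end BlockShift

/-- The function `θ(z) = Y(z)Θ₀` (whose Taylor coefficients are
`Y_ν Θ₀`, where `Y₀ = I_p` and `Y_{ν+1} = −E_p*(S_p*)^ν T_G*(T_G T_G*)⁻¹ H_G E_p`)
belongs to `H^∞_{p×(p−m)}`; i.e. its block Toeplitz operator `T_θ` is bounded; moreover
`θ` is inner (`T_θ` is an isometry) and `ran T_θ = ker T_G`. -/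
theorem bezout_corona_stmt6
    (m p : ℕ) (hm : 0 < m) (hmp : m ≤ p)
    (G : ℕ → Matrix (Fin m) (Fin p) ℂ)
    (TG : l2 p →L[ℂ] l2 m)
    (hTG : ∀ (j : ℕ) (b : Fin p) (i : ℕ) (a : Fin m),
      (TG (lp.single 2 j (eVec p b))) i a = if j ≤ i then G (i - j) a b else 0)
    (HG : l2 p →L[ℂ] l2 m)
    (hHG : ∀ (j : ℕ) (b : Fin p) (i : ℕ) (a : Fin m),
      (HG (lp.single 2 j (eVec p b))) i a = G (i + j + 1) a b)
    (Tinv : l2 m →L[ℂ] l2 m)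
    (hT1 : ∀ x, Tinv (TG (TG.adjoint x)) = x)
    (hT2 : ∀ x, TG (TG.adjoint (Tinv x)) = x)
    (Θ₀ : Matrix (Fin p) (Fin (p - m)) ℂ)
    (hΘ₀ker : ∀ w : Fin (p - m) → ℂ, Θ₀.mulVec w = 0 → w = 0)
    (hΘ₀ : ∀ (a b : Fin p), (Θ₀ * Θ₀ᴴ) a b
      = (if a = b then 1 else 0) - (TG.adjoint (Tinv (TG (lp.single 2 0 (eVec p b))))) 0 a)
    (Yc : ℕ → Matrix (Fin p) (Fin p) ℂ)
    (hYc0 : Yc 0 = 1)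
    (hYc : ∀ (ν : ℕ) (a b : Fin p),
      Yc (ν + 1) a b = -(TG.adjoint (Tinv (HG (lp.single 2 0 (eVec p b))))) ν a) :
    ∃ Tθ : l2 (p - m) →L[ℂ] l2 p,
      (∀ (j : ℕ) (b : Fin (p - m)) (i : ℕ) (a : Fin p),
        (Tθ (lp.single 2 j (eVec (p - m) b))) i a
          = if j ≤ i then (Yc (i - j) * Θ₀) a b else 0) ∧
      (∀ x, ‖Tθ x‖ = ‖x‖) ∧
      Set.range Tθ = {x : l2 p | TG x = 0} := by
  have hS : ∀ x, TG (BlockShift.shift p x) = BlockShift.shift m (TG x) := by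
    have : TG ∘L (BlockShift.shift p).toContinuousLinearMap =
        (BlockShift.shift m).toContinuousLinearMap ∘L TG := by
      refine BlockShift.ext_single fun j b => ?_
      change TG (BlockShift.shift p _) = BlockShift.shift m (TG _)
      rw [BlockShift.shift_single]
      ext i a
      cases i with
      | zero => rw [hTG]; simp
      | succ i => rw [hTG, BlockShift.shift_apply_succ, hTG]; simp
    exact fun x => DFunLike.congr_fun this x
  have hbasis : ∀ {E : Type} [AddCommGroup E] [Module ℂ E] {n : ℕ} {f g : ES n →ₗ[ℂ] E},
      (∀ b, f (eVec n b) = g (eVec n b)) → ∀ v, f v = g v := fun {E} _ _ {n} {f g} h v => by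
    refine DFunLike.congr_fun ((EuclideanSpace.basisFun (Fin n) ℂ).toBasis.ext fun b => ?_) v
    simpa using h b
  have hH : ∀ u i, TG (lp.single 2 0 u) (i + 1) = HG (lp.single 2 0 u) i := fun u i => by
    refine hbasis
      (f := (lp.evalₗ (𝕜 := ℂ) (fun _ => ES m) 2 (i + 1)) ∘ₗ TG.toLinearMap ∘ₗ
        BlockShift.embedZero p)
      (g := (lp.evalₗ (𝕜 := ℂ) (fun _ => ES m) 2 i) ∘ₗ HG.toLinearMap ∘ₗ
        BlockShift.embedZero p)
      (fun b => ?_) u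
    ext a
    change TG (lp.single 2 0 _) (i + 1) a = HG (lp.single 2 0 _) i a
    rw [hTG, hHG]
    simp
  let A := Matrix.toEuclideanLin Θ₀
  let B := Matrix.toEuclideanLin Θ₀ᴴ
  have hBadj : B = A.adjoint := Matrix.toEuclideanLin_conjTranspose_eq_adjoint Θ₀
  have hAinj : Function.Injective A := by
    rw [← LinearMap.ker_eq_bot, LinearMap.ker_eq_bot']
    intro w hw
    have := hΘ₀ker w.ofLp (congrArg WithLp.ofLp hw)
    ext i
    exact congrFun this i
  have hBsurj : Function.Surjective B := by
    rw [← LinearMap.range_eq_top, hBadj, ← Submodule.orthogonal_eq_bot_iff,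
      LinearMap.orthogonal_range, LinearMap.adjoint_adjoint]
    exact LinearMap.ker_eq_bot.2 hAinj
  have hABv : ∀ v, A (B v) = v - TG.adjoint (Tinv (TG (lp.single 2 0 v))) 0 := by
    refine hbasis (f := A ∘ₗ B)
      (g := LinearMap.id - (lp.evalₗ (𝕜 := ℂ) (fun _ => ES p) 2 0) ∘ₗ
        (TG.adjoint ∘L Tinv ∘L TG).toLinearMap ∘ₗ BlockShift.embedZero p) fun b => ?_
    ext a
    change Θ₀.mulVec (Θ₀ᴴ.mulVec (Pi.single b 1)) a = eVec p b a - _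
    rw [Matrix.mulVec_mulVec, Matrix.mulVec_single_one, Matrix.col_apply, hΘ₀]
    congr 1
    simp
  obtain ⟨T, hT, hrange⟩ := BlockShift.exists_isometry_range_eq_ker hS hH hT2 A B
    (fun w v => by rw [hBadj, LinearMap.adjoint_inner_right]) hBsurj hABv
  refine ⟨T.toContinuousLinearMap, fun j b i a => ?_, T.norm_map, hrange⟩
  have hAb : ∀ c, A (eVec (p - m) b) c = Θ₀ c b := fun c => by
    change Θ₀.mulVec (Pi.single b 1) c = _
    rw [Matrix.mulVec_single_one, Matrix.col_apply]
  have hcol : ∀ (k : ℕ) (u : ES p), ((lp.single 2 0 u -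
      BlockShift.shift p (TG.adjoint (Tinv (HG (lp.single 2 0 u)))) : l2 p) k) =
      Matrix.toEuclideanLin (Yc k) u := by
    intro k
    refine hbasis (f := (lp.evalₗ (𝕜 := ℂ) (fun _ => ES p) 2 k) ∘ₗ (BlockShift.embedZero p -
      (BlockShift.shift p).toLinearMap ∘ₗ (TG.adjoint ∘L Tinv ∘L HG).toLinearMap ∘ₗ
        BlockShift.embedZero p)) (g := Matrix.toEuclideanLin (Yc k)) fun c => ?_
    ext d
    change (lp.single 2 0 (eVec p c) : l2 p) k d - BlockShift.shift p _ k d =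
      (Yc k).mulVec (Pi.single c 1) d
    rw [Matrix.mulVec_single_one, Matrix.col_apply]
    cases k with
    | zero => rw [hYc0]; simp [Matrix.one_apply]
    | succ k => rw [hYc, BlockShift.shift_apply_succ]; simp [lp.single_apply]
  change T (lp.single 2 j _) i a = _
  rw [hT, BlockShift.shift_pow_apply]
  split_ifs with hji
  · rw [hcol]
    change (Yc (i - j)).mulVec (A (eVec (p - m) b)).ofLp a = _
    rw [Matrix.mulVec, Matrix.mul_apply, dotProduct]
    simp only [hAb]
  · rfl
end
end

section
/- Let G ∈ W₊^{m×p} (Wiener class) with T_G T_G* strictly positive. Then the operator (T_G T_G*)⁻¹ maps ℓ¹₊(ℂᵐ) (regarded as a linear submanifold of ℓ²₊(ℂᵐ)) into ℓ¹₊(ℂᵐ). -/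
/-!
Setting: `l2 n` models ℓ²₊(ℂⁿ); `lp.single 2 0` is the canonical embedding `E_n`, and
evaluating a sequence at coordinate `k` realizes `E_n* (S_n*)^k`.  Block Toeplitz and
Hankel operators, as well as the (bounded) inverse of `T_G T_G*`, are specified through
their actions on the standard basis vectors of the coordinate spaces.
-/

noncomputable section
open scoped Matrix

open scoped ENNReal
open Filter Topology

/-- The `ℓ²` norm of an extended nonnegative sequence indexed by `ℤ`. -/
def l2Norm (f : ℤ → ℝ≥0∞) : ℝ≥0∞ := (∑' i, f i ^ (2 : ℝ)) ^ (1 / 2 : ℝ)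

theorem l2Norm_mono {f g : ℤ → ℝ≥0∞} (h : ∀ i, f i ≤ g i) : l2Norm f ≤ l2Norm g := by
  unfold l2Norm
  gcongr
  exact h _

theorem l2Norm_add_le (f g : ℤ → ℝ≥0∞) :
    l2Norm (fun i => f i + g i) ≤ l2Norm f + l2Norm g := by
  have h := ENNReal.lintegral_Lp_add_le (μ := MeasureTheory.Measure.count) (p := 2)
    (measurable_of_countable f).aemeasurable (measurable_of_countable g).aemeasurable one_le_two
  simpa [l2Norm, MeasureTheory.lintegral_count] using h

theorem l2Norm_const_mul (c : ℝ≥0∞) (f : ℤ → ℝ≥0∞) :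
    l2Norm (fun i => c * f i) = c * l2Norm f := by
  unfold l2Norm
  simp_rw [ENNReal.mul_rpow_of_nonneg _ _ zero_le_two, ENNReal.tsum_mul_left]
  rw [ENNReal.mul_rpow_of_nonneg _ _ (by norm_num), ← ENNReal.rpow_mul]
  norm_num

theorem l2Norm_comp_sub (f : ℤ → ℝ≥0∞) (d : ℤ) :
    l2Norm (fun i => f (i - d)) = l2Norm f := by
  unfold l2Norm
  rw [← (Equiv.subRight d).tsum_eq (fun i => f i ^ (2 : ℝ))]
  rfl

theorem l2Norm_sum_le {ι : Type*} (F : ι → ℤ → ℝ≥0∞) (s : Finset ι) :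
    l2Norm (fun i => ∑ d ∈ s, F d i) ≤ ∑ d ∈ s, l2Norm (F d) := by
  classical
  induction s using Finset.induction_on with
  | empty => simp [l2Norm]
  | insert a s ha ih =>
    simp_rw [Finset.sum_insert ha]
    exact (l2Norm_add_le _ _).trans (by gcongr)

theorem l2Norm_le_iff {f : ℤ → ℝ≥0∞} {C : ℝ≥0∞} :
    l2Norm f ≤ C ↔ ∑' i, f i ^ (2 : ℝ) ≤ C ^ (2 : ℝ) := by
  rw [l2Norm, one_div, ENNReal.rpow_inv_le_iff two_pos]

theorem l2Norm_tsum_le {ι : Type*} (F : ι → ℤ → ℝ≥0∞) :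
    l2Norm (fun i => ∑' d, F d i) ≤ ∑' d, l2Norm (F d) := by
  rw [l2Norm_le_iff, ENNReal.tsum_eq_iSup_sum]
  refine iSup_le fun s => ?_
  have hlim : Tendsto (fun u : Finset ι => ∑ i ∈ s, (∑ d ∈ u, F d i) ^ (2 : ℝ)) atTop
      (𝓝 (∑ i ∈ s, (∑' d, F d i) ^ (2 : ℝ))) :=
    tendsto_finsetSum _ fun i _ =>
      (ENNReal.continuous_rpow_const.tendsto _).comp ENNReal.summable.hasSum
  refine le_of_tendsto' hlim fun u => (ENNReal.sum_le_tsum s).trans ?_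
  rw [← l2Norm_le_iff]
  exact (l2Norm_sum_le F u).trans (ENNReal.sum_le_tsum u)

theorem apply_le_l2Norm (f : ℤ → ℝ≥0∞) (i : ℤ) : f i ≤ l2Norm f := by
  rw [l2Norm, one_div, ENNReal.le_rpow_inv_iff two_pos]
  exact ENNReal.le_tsum i

theorem l2Norm_le_tsum (f : ℤ → ℝ≥0∞) : l2Norm f ≤ ∑' i, f i := by
  rw [l2Norm_le_iff]
  calc ∑' i, f i ^ (2 : ℝ) ≤ ∑' i, f i * ∑' j, f j := by
        gcongr with i
        rw [ENNReal.rpow_two, sq]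
        gcongr
        exact ENNReal.le_tsum i
    _ = (∑' i, f i) ^ (2 : ℝ) := by rw [ENNReal.tsum_mul_right, ENNReal.rpow_two, sq]

/-- The exponential weight `k ↦ exp (-s |k|)`. -/
def expWeight (s : ℝ) (k : ℤ) : ℝ := Real.exp (-(s * |(k : ℝ)|))

theorem expWeight_nonneg (s : ℝ) (k : ℤ) : 0 ≤ expWeight s k := (Real.exp_pos _).le

theorem expWeight_le_one {s : ℝ} (hs : 0 ≤ s) (k : ℤ) : expWeight s k ≤ 1 :=
  Real.exp_le_one_iff.2 (neg_nonpos.2 (by positivity))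

/-- The relative oscillation of `expWeight s` over distance `d`. -/
def expOsc (s : ℝ) (d : ℤ) : ℝ := min 1 (Real.exp (s * |(d : ℝ)|) - 1)

theorem expWeight_sub_le {s : ℝ} (hs : 0 ≤ s) (k l : ℤ) :
    expWeight s k - expWeight s l ≤ expOsc s (k - l) * (expWeight s k + expWeight s l) := by
  have hk := Real.exp_pos (-(s * |(k : ℝ)|))
  have hl := Real.exp_pos (-(s * |(l : ℝ)|))
  have h : Real.exp (-(s * |(k : ℝ)|)) ≤
      Real.exp (s * |((k - l : ℤ) : ℝ)|) * Real.exp (-(s * |(l : ℝ)|)) := by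
    rw [← Real.exp_add, Real.exp_le_exp]
    have h1 : |(l : ℝ)| - |(k : ℝ)| ≤ |((k - l : ℤ) : ℝ)| := by
      push_cast
      rw [abs_sub_comm]
      exact abs_sub_abs_le_abs_sub _ _
    nlinarith
  have h1 : 1 ≤ Real.exp (s * |((k - l : ℤ) : ℝ)|) := Real.one_le_exp (by positivity)
  unfold expOsc expWeight
  rcases min_cases 1 (Real.exp (s * |((k - l : ℤ) : ℝ)|) - 1) with h2 | h2 <;> rw [h2.1] <;>
    nlinarith

theorem abs_expWeight_sub_le {s : ℝ} (hs : 0 ≤ s) (k l : ℤ) :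
    |expWeight s k - expWeight s l| ≤ expOsc s (k - l) * (expWeight s k + expWeight s l) := by
  rw [abs_le']
  refine ⟨expWeight_sub_le hs k l, ?_⟩
  have h := expWeight_sub_le hs l k
  have e : expOsc s (l - k) = expOsc s (k - l) := by
    unfold expOsc
    push_cast
    rw [abs_sub_comm]
  rw [e] at h
  linarith

theorem expOsc_nonneg {s : ℝ} (hs : 0 ≤ s) (d : ℤ) : 0 ≤ expOsc s d :=
  le_min zero_le_one (sub_nonneg.2 (Real.one_le_exp (by positivity)))

theorem summable_expWeight {s : ℝ} (hs : 0 < s) : Summable (expWeight s) := by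
  have h : Summable fun n : ℕ => Real.exp (-s) ^ n :=
    summable_geometric_of_lt_one (Real.exp_pos _).le (by simpa using hs)
  have e : ∀ n : ℕ, Real.exp (-s) ^ n = Real.exp (-(s * n)) := fun n => by
    rw [← Real.exp_nat_mul]; ring_nf
  refine Summable.of_nat_of_neg ?_ ?_ <;> simpa [expWeight, ← e] using h

/-- The sum over all translates `t` of the `ℓ²` norm of `f` weighted by `expWeight s (· - t)`. -/
def amalgamNorm (s : ℝ) (f : ℤ → ℝ≥0∞) : ℝ≥0∞ :=
  ∑' t : ℤ, l2Norm fun i => ENNReal.ofReal (expWeight s (i - t)) * f i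

theorem amalgamNorm_add_le (s : ℝ) (f g : ℤ → ℝ≥0∞) :
    amalgamNorm s (fun i => f i + g i) ≤ amalgamNorm s f + amalgamNorm s g := by
  unfold amalgamNorm
  rw [← ENNReal.tsum_add]
  gcongr
  simp_rw [mul_add]
  exact l2Norm_add_le _ _

theorem amalgamNorm_mono (s : ℝ) {f g : ℤ → ℝ≥0∞} (h : ∀ i, f i ≤ g i) :
    amalgamNorm s f ≤ amalgamNorm s g := by
  unfold amalgamNorm
  gcongr with t
  refine l2Norm_mono fun i => ?_
  gcongr
  exact h i

theorem tsum_le_amalgamNorm (s : ℝ) (f : ℤ → ℝ≥0∞) : ∑' i, f i ≤ amalgamNorm s f := by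
  refine ENNReal.tsum_le_tsum fun t => ?_
  simpa [expWeight] using
    apply_le_l2Norm (fun i => ENNReal.ofReal (expWeight s (i - t)) * f i) t

theorem amalgamNorm_le_mul_tsum (s : ℝ) (f : ℤ → ℝ≥0∞) :
    amalgamNorm s f ≤ (∑' k, ENNReal.ofReal (expWeight s k)) * ∑' i, f i := by
  calc amalgamNorm s f
      ≤ ∑' t : ℤ, ∑' i : ℤ, ENNReal.ofReal (expWeight s (i - t)) * f i :=
        ENNReal.tsum_le_tsum fun t => l2Norm_le_tsum _
    _ = ∑' i : ℤ, ∑' t : ℤ, ENNReal.ofReal (expWeight s (i - t)) * f i := ENNReal.tsum_comm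
    _ = ∑' i : ℤ, (∑' k, ENNReal.ofReal (expWeight s k)) * f i := by
        refine tsum_congr fun i => ?_
        rw [ENNReal.tsum_mul_right,
          ← (Equiv.subLeft i).tsum_eq fun k => ENNReal.ofReal (expWeight s k)]
        rfl
    _ = _ := ENNReal.tsum_mul_left

theorem exists_tsum_mul_expOsc_lt {β : ℤ → ℝ≥0∞} (hβ : ∑' d, β d ≠ ∞) {ε : ℝ≥0∞}
    (hε : ε ≠ 0) :
    ∃ s : ℝ, 0 < s ∧ ∑' d, β d * ENNReal.ofReal (expOsc s d) < ε := by
  have hlim : Tendsto (fun n : ℕ => ∑' d, β d * ENNReal.ofReal (expOsc (1 / ((n : ℝ) + 1)) d))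
      atTop (𝓝 (∑' d : ℤ, 0)) := by
    simp_rw [← MeasureTheory.lintegral_count]
    refine MeasureTheory.tendsto_lintegral_of_dominated_convergence β
      (fun n => measurable_of_countable _) (fun n => MeasureTheory.ae_of_all _ fun d => ?_)
      (by rwa [MeasureTheory.lintegral_count]) (MeasureTheory.ae_of_all _ fun d => ?_)
    · refine mul_le_of_le_one_right' ?_
      rw [ENNReal.ofReal_le_one]
      exact min_le_left _ _
    · have h1 : Tendsto (fun n : ℕ => expOsc (1 / ((n : ℝ) + 1)) d) atTop (𝓝 0) := by
        have h2 : Continuous fun s : ℝ => expOsc s d := by unfold expOsc; fun_prop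
        have h3 := (h2.tendsto 0).comp tendsto_one_div_add_atTop_nhds_zero_nat
        simpa [expOsc, Function.comp_def] using h3
      have h4 := ENNReal.Tendsto.const_mul (a := β d) (ENNReal.tendsto_ofReal h1)
        (Or.inr (ENNReal.ne_top_of_tsum_ne_top hβ d))
      simpa using h4
  rw [tsum_zero] at hlim
  obtain ⟨n, hn⟩ := (hlim.eventually_lt_const (pos_iff_ne_zero.2 hε)).exists
  exact ⟨_, by positivity, hn⟩

theorem tsum_natCast_le (f : ℤ → ℝ≥0∞) : ∑' n : ℕ, f n ≤ ∑' k, f k :=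
  ENNReal.tsum_comp_le_tsum_of_injective Nat.cast_injective f

/-- The sequence of norms of `x`, extended by zero to the negative integers. -/
def normSeq {E : Type*} [NormedAddCommGroup E] (x : ℕ → E) : ℤ → ℝ≥0∞
  | .ofNat n => ‖x n‖ₑ
  | .negSucc _ => 0

section Operators

variable {E F H : Type*} [NormedAddCommGroup E] [NormedAddCommGroup F] [NormedAddCommGroup H]

@[simp]
theorem normSeq_natCast (x : ℕ → E) (n : ℕ) : normSeq x n = ‖x n‖ₑ := rfl

@[simp]
theorem normSeq_negSucc (x : ℕ → E) (n : ℕ) : normSeq x (.negSucc n) = 0 := rfl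

theorem tsum_int_eq_tsum_nat {f : ℤ → ℝ≥0∞} (hf : ∀ n, f (.negSucc n) = 0) :
    ∑' k, f k = ∑' n : ℕ, f n := by
  refine (Function.Injective.tsum_eq Nat.cast_injective fun k hk => ?_).symm
  cases k with
  | ofNat n => exact ⟨n, rfl⟩
  | negSucc n => exact absurd (hf n) hk

theorem tsum_normSeq (x : ℕ → E) : ∑' k, normSeq x k = ∑' n, ‖x n‖ₑ :=
  tsum_int_eq_tsum_nat fun _ => rfl

theorem l2Norm_normSeq (x : lp (fun _ : ℕ => E) 2) : l2Norm (normSeq x) = ‖x‖ₑ := by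
  have h2 : (2 : ℝ≥0∞).toReal = 2 := rfl
  have hs := (lp.memℓp x).summable (by norm_num)
  have h := lp.norm_rpow_eq_tsum (by norm_num) x
  rw [h2] at hs h
  have : ∑' k, normSeq x k ^ (2 : ℝ) = ‖x‖ₑ ^ (2 : ℝ) := by
    rw [tsum_int_eq_tsum_nat fun n => by simp]
    simp_rw [normSeq_natCast, ← ofReal_norm,
      ENNReal.ofReal_rpow_of_nonneg (norm_nonneg _) zero_le_two]
    rw [h, ENNReal.ofReal_tsum_of_nonneg (fun _ => by positivity) hs]
  rw [l2Norm, this, ← ENNReal.rpow_mul]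
  norm_num

variable [NormedSpace ℂ E] [NormedSpace ℂ F] [NormedSpace ℂ H]

/-- An operator between `ℓ²` spaces is convolution-dominated by `β` if the norm of its `(i, j)`-th
block is at most `β (i - j)`. -/
def ConvDominated (A : lp (fun _ : ℕ => E) 2 →L[ℂ] lp (fun _ : ℕ => F) 2) (β : ℤ → ℝ≥0∞) : Prop :=
  ∀ (j : ℕ) (v : E) (i : ℕ), ‖A (lp.single 2 j v) i‖ₑ ≤ β ((i : ℤ) - j) * ‖v‖ₑ

theorem hasSum_apply_single (A : lp (fun _ : ℕ => E) 2 →L[ℂ] lp (fun _ : ℕ => F) 2)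
    (x : lp (fun _ : ℕ => E) 2) (i : ℕ) :
    HasSum (fun j => A (lp.single 2 j (x j)) i) (A x i) :=
  ((lp.hasSum_single (by norm_num) x).mapL A).mapL (lp.evalCLM ℂ (fun _ : ℕ => F) 2 i)

theorem ConvDominated.enorm_apply_le {A : lp (fun _ : ℕ => E) 2 →L[ℂ] lp (fun _ : ℕ => F) 2}
    {β : ℤ → ℝ≥0∞} (hA : ConvDominated A β) (x : lp (fun _ : ℕ => E) 2) (i : ℕ) :
    ‖A x i‖ₑ ≤ ∑' j : ℕ, β ((i : ℤ) - j) * ‖x j‖ₑ := by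
  rw [← (hasSum_apply_single A x i).tsum_eq]
  exact tsum_of_enorm_bounded ENNReal.summable.hasSum fun j => hA j (x j) i

theorem ConvDominated.comp {A : lp (fun _ : ℕ => E) 2 →L[ℂ] lp (fun _ : ℕ => F) 2}
    {B : lp (fun _ : ℕ => F) 2 →L[ℂ] lp (fun _ : ℕ => H) 2} {α β : ℤ → ℝ≥0∞}
    (hB : ConvDominated B β) (hA : ConvDominated A α) :
    ConvDominated (B ∘L A) fun d => ∑' k, β (d - k) * α k := by
  intro j v i
  refine (hB.enorm_apply_le _ i).trans ?_
  calc ∑' k : ℕ, β ((i : ℤ) - k) * ‖A (lp.single 2 j v) k‖ₑ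
      ≤ ∑' k : ℕ, β ((i : ℤ) - k) * (α ((k : ℤ) - j) * ‖v‖ₑ) := by
        gcongr with k
        exact hA j v k
    _ ≤ ∑' k : ℤ, β ((i : ℤ) - k) * (α (k - j) * ‖v‖ₑ) :=
        tsum_natCast_le fun k => β ((i : ℤ) - k) * (α (k - j) * ‖v‖ₑ)
    _ = (∑' k : ℤ, β ((i : ℤ) - j - k) * α k) * ‖v‖ₑ := by
        rw [← ENNReal.tsum_mul_right, ← (Equiv.subRight (j : ℤ)).tsum_eq fun k =>
          β ((i : ℤ) - j - k) * α k * ‖v‖ₑ]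
        refine tsum_congr fun k => ?_
        simp only [Equiv.subRight_apply, sub_sub_sub_cancel_right, mul_assoc]

theorem tsum_conv (α β : ℤ → ℝ≥0∞) :
    ∑' d, ∑' k, β (d - k) * α k = (∑' d, β d) * ∑' k, α k := by
  rw [ENNReal.tsum_comm, ← ENNReal.tsum_mul_left]
  refine tsum_congr fun k => ?_
  rw [ENNReal.tsum_mul_right, ← (Equiv.subRight k).tsum_eq β]
  rfl

theorem ConvDominated.sub {A B : lp (fun _ : ℕ => E) 2 →L[ℂ] lp (fun _ : ℕ => F) 2}
    {α β : ℤ → ℝ≥0∞} (hA : ConvDominated A α) (hB : ConvDominated B β) :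
    ConvDominated (A - B) fun d => α d + β d := by
  intro j v i
  rw [add_mul]
  exact (enorm_sub_le (a := A (lp.single 2 j v) i) (b := B (lp.single 2 j v) i)).trans
    (add_le_add (hA j v i) (hB j v i))

theorem ConvDominated.const_smul {A : lp (fun _ : ℕ => E) 2 →L[ℂ] lp (fun _ : ℕ => F) 2}
    {α : ℤ → ℝ≥0∞} (hA : ConvDominated A α) (c : ℂ) :
    ConvDominated (c • A) fun d => ‖c‖ₑ * α d := by
  intro j v i
  have h : (c • A) (lp.single 2 j v) i = c • A (lp.single 2 j v) i := rfl
  rw [h, enorm_smul, mul_assoc]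
  gcongr
  exact hA j v i

theorem convDominated_id :
    ConvDominated (ContinuousLinearMap.id ℂ (lp (fun _ : ℕ => E) 2)) (Pi.single 0 1) := by
  intro j v i
  rcases eq_or_ne i j with rfl | h
  · simp
  · simp [Pi.single_eq_of_ne h]

/-- Coordinatewise multiplication of an `ℓ²` sequence by `expWeight s (· - t)`. -/
def expWeightMul {s : ℝ} (hs : 0 ≤ s) (t : ℤ) (x : lp (fun _ : ℕ => E) 2) :
    lp (fun _ : ℕ => E) 2 :=
  ⟨fun i => (expWeight s (i - t) : ℂ) • x i, by
    have hx := (lp.memℓp x).summable (by norm_num)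
    refine memℓp_gen (hx.of_nonneg_of_le (fun _ => by positivity) fun i => ?_)
    gcongr
    rw [norm_smul, Complex.norm_real, Real.norm_of_nonneg (expWeight_nonneg _ _)]
    exact mul_le_of_le_one_left (norm_nonneg _) (expWeight_le_one hs _)⟩

theorem expWeightMul_apply {s : ℝ} (hs : 0 ≤ s) (t : ℤ) (x : lp (fun _ : ℕ => E) 2) (i : ℕ) :
    expWeightMul hs t x i = (expWeight s (i - t) : ℂ) • x i := rfl

theorem enorm_ofReal_expWeight (s : ℝ) (k : ℤ) :
    ‖(expWeight s k : ℂ)‖ₑ = ENNReal.ofReal (expWeight s k) := by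
  rw [← ofReal_norm, Complex.norm_real, Real.norm_of_nonneg (expWeight_nonneg _ _)]

theorem normSeq_expWeightMul {s : ℝ} (hs : 0 ≤ s) (t : ℤ) (x : lp (fun _ : ℕ => E) 2) (k : ℤ) :
    normSeq (expWeightMul hs t x) k = ENNReal.ofReal (expWeight s (k - t)) * normSeq x k := by
  cases k with
  | ofNat n =>
    change ‖(expWeight s ((n : ℤ) - t) : ℂ) • x n‖ₑ = _
    rw [enorm_smul, enorm_ofReal_expWeight]
    rfl
  | negSucc n => simp

theorem amalgamNorm_normSeq {s : ℝ} (hs : 0 ≤ s) (x : lp (fun _ : ℕ => E) 2) :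
    amalgamNorm s (normSeq x) = ∑' t, ‖expWeightMul hs t x‖ₑ := by
  simp_rw [← l2Norm_normSeq, amalgamNorm]
  congr! with t k
  exact (normSeq_expWeightMul hs t x k).symm

theorem ConvDominated.enorm_commutator_le
    {A : lp (fun _ : ℕ => E) 2 →L[ℂ] lp (fun _ : ℕ => F) 2} {β : ℤ → ℝ≥0∞}
    (hA : ConvDominated A β) {s : ℝ} (hs : 0 ≤ s) (t : ℤ) (x : lp (fun _ : ℕ => E) 2) (i : ℕ) :
    ‖expWeightMul hs t (A x) i - A (expWeightMul hs t x) i‖ₑ ≤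
      ∑' d : ℤ, β d * ENNReal.ofReal (expOsc s d) *
        (ENNReal.ofReal (expWeight s (i - t)) + ENNReal.ofReal (expWeight s (i - d - t))) *
          normSeq x (i - d) := by
  have h1 : HasSum (fun j : ℕ => ((expWeight s (i - t) : ℂ) - (expWeight s (j - t) : ℂ)) •
      A (lp.single 2 j (x j)) i)
      (expWeightMul hs t (A x) i - A (expWeightMul hs t x) i) := by
    have h2 := ((hasSum_apply_single A x i).const_smul (expWeight s (i - t) : ℂ)).sub
      (hasSum_apply_single A (expWeightMul hs t x) i)
    refine Eq.mpr (congrArg (HasSum · _) (funext fun j => ?_)) h2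
    have h3 : (lp.single 2 j (expWeightMul hs t x j) : lp (fun _ : ℕ => E) 2) =
        (expWeight s (j - t) : ℂ) • lp.single 2 j (x j) := lp.single_smul 2 j _ _
    rw [h3, map_smul, sub_smul]
    rfl
  rw [← h1.tsum_eq]
  calc _ ≤ ∑' j : ℕ, β (i - j) * ENNReal.ofReal (expOsc s (i - j)) *
        (ENNReal.ofReal (expWeight s (i - t)) + ENNReal.ofReal (expWeight s (j - t))) *
          normSeq x j := by
        refine tsum_of_enorm_bounded ENNReal.summable.hasSum fun j => ?_
        rw [enorm_smul, ← Complex.ofReal_sub, ← ofReal_norm (Complex.ofReal _),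
          Complex.norm_real, Real.norm_eq_abs,
          ← ENNReal.ofReal_add (expWeight_nonneg _ _) (expWeight_nonneg _ _)]
        have h3 := ENNReal.ofReal_le_ofReal
          (abs_expWeight_sub_le hs ((i : ℤ) - t) ((j : ℤ) - t))
        rw [sub_sub_sub_cancel_right, ENNReal.ofReal_mul (expOsc_nonneg hs _)] at h3
        refine (mul_le_mul' h3 (hA j (x j) i)).trans_eq ?_
        rw [normSeq_natCast]
        ring
    _ ≤ ∑' j : ℤ, β (i - j) * ENNReal.ofReal (expOsc s (i - j)) *
        (ENNReal.ofReal (expWeight s (i - t)) + ENNReal.ofReal (expWeight s (j - t))) *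
          normSeq x j :=
        tsum_natCast_le fun j => β (i - j) * ENNReal.ofReal (expOsc s (i - j)) *
          (ENNReal.ofReal (expWeight s (i - t)) + ENNReal.ofReal (expWeight s (j - t))) *
            normSeq x j
    _ = _ := by
        rw [← (Equiv.subLeft (i : ℤ)).tsum_eq]
        simp

/-- A convolution-dominated operator is bounded for `amalgamNorm s`, with a bound that is close to
its `ℓ²` operator norm when `s` is small. -/
theorem ConvDominated.amalgamNorm_le
    {A : lp (fun _ : ℕ => E) 2 →L[ℂ] lp (fun _ : ℕ => F) 2} {β : ℤ → ℝ≥0∞}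
    (hA : ConvDominated A β) {s : ℝ} (hs : 0 ≤ s) (x : lp (fun _ : ℕ => E) 2) :
    amalgamNorm s (normSeq (A x)) ≤
      (‖A‖ₑ + 2 * ∑' d, β d * ENNReal.ofReal (expOsc s d)) * amalgamNorm s (normSeq x) := by
  have key : ∀ t : ℤ, ‖expWeightMul hs t (A x)‖ₑ ≤ ‖A‖ₑ * ‖expWeightMul hs t x‖ₑ +
      ∑' d : ℤ, β d * ENNReal.ofReal (expOsc s d) *
        (‖expWeightMul hs (t - d) x‖ₑ + ‖expWeightMul hs t x‖ₑ) := by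
    intro t
    have h1 : ‖expWeightMul hs t (A x)‖ₑ ≤ ‖A (expWeightMul hs t x)‖ₑ +
        ‖expWeightMul hs t (A x) - A (expWeightMul hs t x)‖ₑ := by
      simpa using enorm_add_le (a := A (expWeightMul hs t x))
        (b := expWeightMul hs t (A x) - A (expWeightMul hs t x))
    refine h1.trans (add_le_add (A.le_opENorm _) ?_)
    rw [← l2Norm_normSeq]
    refine (l2Norm_mono fun k => ?_).trans ((l2Norm_tsum_le fun (d : ℤ) k =>
      β d * ENNReal.ofReal (expOsc s d) * (normSeq (expWeightMul hs (t - d) x) (k - d) +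
        normSeq (expWeightMul hs t x) (k - d))).trans ?_)
    · cases k with
      | ofNat n =>
        refine (hA.enorm_commutator_le hs t x n).trans_eq (tsum_congr fun d => ?_)
        simp only [normSeq_expWeightMul, Int.ofNat_eq_natCast, sub_sub_sub_cancel_right]
        ring
      | negSucc n => exact zero_le
    · gcongr with d
      rw [l2Norm_const_mul]
      gcongr
      refine (l2Norm_add_le _ _).trans_eq ?_
      rw [l2Norm_comp_sub, l2Norm_comp_sub, l2Norm_normSeq, l2Norm_normSeq]
  rw [amalgamNorm_normSeq hs, amalgamNorm_normSeq hs]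
  refine (ENNReal.tsum_le_tsum key).trans_eq ?_
  rw [ENNReal.tsum_add, ENNReal.tsum_mul_left, add_mul, ENNReal.tsum_comm, mul_assoc,
    ← ENNReal.tsum_mul_right, ← ENNReal.tsum_mul_left (a := 2)]
  refine congrArg _ ?_
  refine tsum_congr fun d => ?_
  rw [ENNReal.tsum_mul_left, ENNReal.tsum_add,
    show ∑' t, ‖expWeightMul hs (t - d) x‖ₑ = ∑' t, ‖expWeightMul hs t x‖ₑ from
      (Equiv.subRight d).tsum_eq fun t => ‖expWeightMul hs t x‖ₑ]
  ring

end Operators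

/-- If `B` is a convolution-dominated strict contraction on `ℓ²`, then the solution `y` of
`y = B y + z` is absolutely summable whenever `z` is. -/
theorem summable_norm_of_eq_apply_add {E : Type*} [NormedAddCommGroup E] [NormedSpace ℂ E]
    {B : lp (fun _ : ℕ => E) 2 →L[ℂ] lp (fun _ : ℕ => E) 2} {β : ℤ → ℝ≥0∞}
    (hB : ConvDominated B β) (hβ : ∑' d, β d ≠ ∞) (hB1 : ‖B‖ < 1)
    {y z : lp (fun _ : ℕ => E) 2} (hy : y = B y + z) (hz : Summable fun i => ‖z i‖) :
    Summable fun i => ‖y i‖ := by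
  have hB1' : ‖B‖ₑ < 1 := by
    rw [← ofReal_norm]
    exact ENNReal.ofReal_lt_one.2 hB1
  obtain ⟨s, hs, hsβ⟩ := exists_tsum_mul_expOsc_lt hβ (ε := (1 - ‖B‖ₑ) / 2)
    (ENNReal.div_pos (tsub_pos_of_lt hB1').ne' (by norm_num)).ne'
  set r := ‖B‖ₑ + 2 * ∑' d, β d * ENNReal.ofReal (expOsc s d)
  have hr : r < 1 := by
    rw [ENNReal.lt_div_iff_mul_lt (by norm_num) (by norm_num), mul_comm] at hsβ
    exact lt_tsub_iff_left.1 hsβ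
  have hM : ∀ x : lp (fun _ : ℕ => E) 2,
      amalgamNorm s (normSeq (B x)) ≤ r * amalgamNorm s (normSeq x) :=
    hB.amalgamNorm_le hs.le
  set K := amalgamNorm s (normSeq z) / (1 - r)
  have hr0 : 1 - r ≠ 0 := (tsub_pos_of_lt hr).ne'
  have hrt : 1 - r ≠ ∞ := (tsub_le_self.trans_lt ENNReal.one_lt_top).ne
  have hK : r * K + amalgamNorm s (normSeq z) = K := by
    have h1 : amalgamNorm s (normSeq z) = (1 - r) * K := (ENNReal.mul_div_cancel hr0 hrt).symm
    rw [h1, ← add_mul, add_tsub_cancel_of_le hr.le, one_mul]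
  have hKt : K ≠ ∞ := by
    refine (ENNReal.div_lt_top ?_ hr0).ne
    refine ne_top_of_le_ne_top (ENNReal.mul_ne_top ?_ ?_) (amalgamNorm_le_mul_tsum s _)
    · exact (summable_expWeight hs).tsum_ofReal_ne_top
    · rw [tsum_normSeq]
      exact tsum_enorm_ne_top_iff_summable_norm.2 hz
  let u : ℕ → lp (fun _ : ℕ => E) 2 := fun n => (fun w => B w + z)^[n] 0
  have hu : ∀ n, u (n + 1) = B (u n) + z := fun n => Function.iterate_succ_apply' _ _ _
  have huK : ∀ n, amalgamNorm s (normSeq (u n)) ≤ K := by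
    intro n
    induction n with
    | zero =>
      have h0 : normSeq (u 0) = fun _ => 0 := by
        funext k
        cases k with
        | ofNat n => exact enorm_zero
        | negSucc n => rfl
      rw [h0]
      simp [amalgamNorm, l2Norm]
    | succ n ih =>
      have h1 : ∀ k, normSeq (u (n + 1)) k ≤ normSeq (B (u n)) k + normSeq z k := by
        intro k
        rw [hu]
        cases k with
        | ofNat m => exact enorm_add_le (a := B (u n) m) (b := z m)
        | negSucc m => exact zero_le
      calc _ ≤ _ := amalgamNorm_mono s h1
        _ ≤ _ := amalgamNorm_add_le s _ _
        _ ≤ r * K + amalgamNorm s (normSeq z) := by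
          gcongr
          exact (hM _).trans (by gcongr)
        _ = K := hK
  have hdist : ∀ n, ‖u n - y‖ ≤ ‖B‖ ^ n * ‖y‖ := by
    intro n
    induction n with
    | zero => simp [u]
    | succ n ih =>
      have h1 : u (n + 1) - y = B (u n - y) := by
        rw [hu, map_sub]
        nth_rewrite 1 [hy]
        abel
      rw [h1, pow_succ', mul_assoc]
      exact (B.le_opNorm _).trans (by gcongr)
  have hlim : Tendsto u atTop (𝓝 y) := by
    rw [tendsto_iff_norm_sub_tendsto_zero]
    refine squeeze_zero (fun _ => norm_nonneg _) hdist ?_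
    simpa using (tendsto_pow_atTop_nhds_zero_of_lt_one (norm_nonneg B) hB1).mul_const ‖y‖
  refine tsum_enorm_ne_top_iff_summable_norm.1 (ne_top_of_le_ne_top hKt ?_)
  rw [ENNReal.tsum_eq_iSup_sum]
  refine iSup_le fun S => ?_
  have hcoord : Tendsto (fun n => ∑ i ∈ S, ‖u n i‖ₑ) atTop (𝓝 (∑ i ∈ S, ‖y i‖ₑ)) :=
    tendsto_finsetSum _ fun i _ =>
      (((lp.evalCLM ℂ (fun _ : ℕ => E) 2 i).continuous.tendsto y).comp hlim).enorm
  refine le_of_tendsto' hcoord fun n => (ENNReal.sum_le_tsum S).trans ?_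
  rw [← tsum_normSeq]
  exact (tsum_le_amalgamNorm s _).trans (huK n)

section InnerProduct

variable {E F : Type*} [NormedAddCommGroup E] [InnerProductSpace ℂ E] [CompleteSpace E]
  [NormedAddCommGroup F] [InnerProductSpace ℂ F] [CompleteSpace F]

theorem ConvDominated.adjoint {A : lp (fun _ : ℕ => E) 2 →L[ℂ] lp (fun _ : ℕ => F) 2}
    {α : ℤ → ℝ≥0∞} (hA : ConvDominated A α) : ConvDominated A.adjoint fun d => α (-d) := by
  intro j v i
  set w : E := A.adjoint (lp.single 2 j v) i
  rcases eq_or_ne w 0 with hw | hw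
  · simp [hw]
  have h1 : inner ℂ w w = inner ℂ v (A (lp.single 2 i w) j) := by
    calc inner ℂ w w = inner ℂ (A.adjoint (lp.single 2 j v)) (lp.single 2 i w) :=
          (lp.inner_single_right (𝕜 := ℂ) i w (A.adjoint (lp.single 2 j v))).symm
      _ = inner ℂ (lp.single 2 j v) (A (lp.single 2 i w)) :=
          ContinuousLinearMap.adjoint_inner_left _ _ _
      _ = _ := lp.inner_single_left (𝕜 := ℂ) j v (A (lp.single 2 i w))
  have h2 : ‖w‖ₑ * ‖w‖ₑ ≤ α (-((i : ℤ) - j)) * ‖v‖ₑ * ‖w‖ₑ := by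
    have h3 : ‖w‖ * ‖w‖ ≤ ‖v‖ * ‖A (lp.single 2 i w) j‖ := by
      rw [← sq, ← inner_self_eq_norm_sq (𝕜 := ℂ), h1]
      exact re_inner_le_norm _ _
    have h4 := ENNReal.ofReal_le_ofReal h3
    rw [ENNReal.ofReal_mul (norm_nonneg _), ENNReal.ofReal_mul (norm_nonneg _)] at h4
    simp only [ofReal_norm] at h4
    refine h4.trans ((mul_le_mul_right (hA i w j) _).trans_eq ?_)
    rw [neg_sub]
    ring
  exact (ENNReal.mul_le_mul_iff_left (by simpa using hw) enorm_ne_top).1 h2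

theorem exists_norm_id_sub_smul_comp_adjoint_lt_one
    (A : lp (fun _ : ℕ => E) 2 →L[ℂ] lp (fun _ : ℕ => F) 2)
    (L : lp (fun _ : ℕ => F) 2 →L[ℂ] lp (fun _ : ℕ => F) 2) (hL : ∀ x, L (A (A.adjoint x)) = x) :
    ∃ c : ℝ, ‖ContinuousLinearMap.id ℂ _ - (c : ℂ) • (A ∘L A.adjoint)‖ < 1 := by
  set κ := ‖L‖ * ‖A‖ + 1
  set N := ‖A‖ + 1
  have hκ : 1 ≤ κ := le_add_of_nonneg_left (by positivity)
  have hN : 1 ≤ N := le_add_of_nonneg_left (by positivity)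
  set c := 1 / N ^ 2
  have hc : 0 < c := by positivity
  have hcN : c * N ^ 2 = 1 := by simp only [c]; field_simp
  have hc1 : c ≤ 1 := by rw [div_le_one (by positivity)]; exact one_le_pow₀ hN
  have hq0 : 0 ≤ 1 - c / κ ^ 2 := by
    rw [sub_nonneg, div_le_one (by positivity)]
    exact hc1.trans (one_le_pow₀ hκ)
  refine ⟨c, lt_of_le_of_lt (ContinuousLinearMap.opNorm_le_bound _
    (Real.sqrt_nonneg (1 - c / κ ^ 2)) fun x => ?_) ?_⟩
  · set a := A.adjoint x
    have h1 : ‖x‖ ≤ κ * ‖a‖ := by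
      calc ‖x‖ = ‖L (A a)‖ := by rw [hL]
        _ ≤ ‖L‖ * (‖A‖ * ‖a‖) := (L.le_opNorm _).trans (by gcongr; exact A.le_opNorm _)
        _ ≤ κ * ‖a‖ := by
          rw [← mul_assoc]
          gcongr
          exact le_add_of_nonneg_right zero_le_one
    have h2 : ‖A a‖ ≤ N * ‖a‖ :=
      (A.le_opNorm _).trans (by gcongr; exact le_add_of_nonneg_right zero_le_one)
    have h3 : RCLike.re (inner ℂ x ((c : ℂ) • A a)) = c * ‖a‖ ^ 2 := by
      rw [inner_smul_right, ← ContinuousLinearMap.adjoint_inner_left, inner_self_eq_norm_sq_to_K]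
      norm_cast
      exact Complex.re_ofReal_mul _ _
    have h4 : ‖x - (c : ℂ) • A a‖ ^ 2 = ‖x‖ ^ 2 - 2 * (c * ‖a‖ ^ 2) + c ^ 2 * ‖A a‖ ^ 2 := by
      rw [norm_sub_sq (𝕜 := ℂ), h3, norm_smul, Complex.norm_real, Real.norm_of_nonneg hc.le,
        mul_pow]
    have h5 : c ^ 2 * ‖A a‖ ^ 2 ≤ c * ‖a‖ ^ 2 := by
      calc c ^ 2 * ‖A a‖ ^ 2 ≤ c ^ 2 * (N * ‖a‖) ^ 2 := by gcongr
        _ = c * (c * N ^ 2) * ‖a‖ ^ 2 := by ring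
        _ = c * ‖a‖ ^ 2 := by rw [hcN, mul_one]
    have h6 : c / κ ^ 2 * ‖x‖ ^ 2 ≤ c * ‖a‖ ^ 2 := by
      calc c / κ ^ 2 * ‖x‖ ^ 2 ≤ c / κ ^ 2 * (κ * ‖a‖) ^ 2 := by gcongr
        _ = c * ‖a‖ ^ 2 := by field_simp
    change ‖x - (c : ℂ) • A a‖ ≤ _
    refine le_of_sq_le_sq ?_ (by positivity)
    rw [mul_pow, Real.sq_sqrt hq0, h4]
    linarith
  · rw [Real.sqrt_lt' one_pos, one_pow]
    exact sub_lt_self _ (by positivity)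

end InnerProduct

theorem enorm_le_sum_enorm {n : ℕ} (w : ES n) : ‖w‖ₑ ≤ ∑ a, ‖w a‖ₑ := by
  have h := (EuclideanSpace.basisFun (Fin n) ℂ).sum_repr w
  calc ‖w‖ₑ = ‖∑ a, w a • EuclideanSpace.basisFun (Fin n) ℂ a‖ₑ := by
        conv_lhs => rw [← h]
        simp
    _ ≤ ∑ a, ‖w a • EuclideanSpace.basisFun (Fin n) ℂ a‖ₑ := enorm_sum_le _ _
    _ = _ := by
        refine Finset.sum_congr rfl fun a _ => ?_
        rw [enorm_smul, ← ofReal_norm (EuclideanSpace.basisFun (Fin n) ℂ a),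
          OrthonormalBasis.norm_eq_one, ENNReal.ofReal_one, mul_one]

/-- The sequence of entrywise `ℓ¹` norms of matrix coefficients, extended by zero to the negative
integers. -/
def coeffSeq {m p : ℕ} (G : ℕ → Matrix (Fin m) (Fin p) ℂ) : ℤ → ℝ≥0∞
  | .ofNat n => ∑ b, ∑ a, ‖G n a b‖ₑ
  | .negSucc _ => 0

theorem tsum_coeffSeq_ne_top {m p : ℕ} {G : ℕ → Matrix (Fin m) (Fin p) ℂ}
    (hG : ∀ a b, Summable fun ν => ‖G ν a b‖) : ∑' d, coeffSeq G d ≠ ∞ := by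
  rw [tsum_int_eq_tsum_nat fun _ => rfl]
  change ∑' n : ℕ, ∑ b, ∑ a, ‖G n a b‖ₑ ≠ ∞
  simp_rw [Summable.tsum_finsetSum fun _ _ => ENNReal.summable]
  simpa [ENNReal.sum_eq_top] using
    fun b a => tsum_enorm_ne_top_iff_summable_norm.2 (hG a b)

/-- A block Toeplitz operator is convolution-dominated by its coefficient norms. -/
theorem convDominated_toeplitz {m p : ℕ} {G : ℕ → Matrix (Fin m) (Fin p) ℂ} {A : l2 p →L[ℂ] l2 m}
    (hA : ∀ (j : ℕ) (b : Fin p) (i : ℕ) (a : Fin m),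
      (A (lp.single 2 j (eVec p b))) i a = if j ≤ i then G (i - j) a b else 0) :
    ConvDominated A (coeffSeq G) := by
  intro j v i
  have hv : A (lp.single 2 j v) i = ∑ b, v b • A (lp.single 2 j (eVec p b)) i := by
    let f : ES p →ₗ[ℂ] ES m := (lp.evalₗ (𝕜 := ℂ) (fun _ : ℕ => ES m) 2 i) ∘ₗ
      A.toLinearMap ∘ₗ lp.lsingle (𝕜 := ℂ) (E := fun _ : ℕ => ES p) 2 j
    have h : v = ∑ b, v b • eVec p b := by
      simpa using ((EuclideanSpace.basisFun (Fin p) ℂ).sum_repr v).symm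
    change f v = ∑ b, v b • f (eVec p b)
    conv_lhs => rw [h]
    simp only [map_sum, map_smul]
  have hcol : ∑ b, ‖A (lp.single 2 j (eVec p b)) i‖ₑ ≤ coeffSeq G ((i : ℤ) - j) := by
    by_cases hij : j ≤ i
    · rw [← Nat.cast_sub hij]
      refine Finset.sum_le_sum fun b _ => (enorm_le_sum_enorm _).trans_eq ?_
      simp [hA, hij]
    · refine le_of_eq_of_le (Finset.sum_eq_zero fun b _ => ?_) zero_le
      refine le_antisymm ((enorm_le_sum_enorm _).trans_eq ?_) zero_le
      simp [hA, hij]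
  rw [hv]
  calc _ ≤ ∑ b, ‖v b • A (lp.single 2 j (eVec p b)) i‖ₑ := enorm_sum_le _ _
    _ ≤ ∑ b, ‖A (lp.single 2 j (eVec p b)) i‖ₑ * ‖v‖ₑ := by
        gcongr with b
        rw [enorm_smul, mul_comm]
        gcongr
        exact PiLp.enorm_apply_le v b
    _ ≤ _ := by
        rw [← Finset.sum_mul]
        gcongr

/-- If `G` belongs to the Wiener class `W₊^{m×p}` (its Taylor
coefficients are absolutely summable) and `T_G T_G*` is strictly positive, then
`(T_G T_G*)⁻¹` maps `ℓ¹₊(ℂᵐ)` (inside `ℓ²₊(ℂᵐ)`) into `ℓ¹₊(ℂᵐ)`. -/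
theorem bezout_corona_stmt10
    (m p : ℕ) (hm : 0 < m) (hmp : m ≤ p)
    (G : ℕ → Matrix (Fin m) (Fin p) ℂ)
    (hGW : ∀ (a : Fin m) (b : Fin p), Summable fun ν => ‖G ν a b‖)
    (TG : l2 p →L[ℂ] l2 m)
    (hTG : ∀ (j : ℕ) (b : Fin p) (i : ℕ) (a : Fin m),
      (TG (lp.single 2 j (eVec p b))) i a = if j ≤ i then G (i - j) a b else 0)
    (Tinv : l2 m →L[ℂ] l2 m)
    (hT1 : ∀ x, Tinv (TG (TG.adjoint x)) = x)
    (hT2 : ∀ x, TG (TG.adjoint (Tinv x)) = x) :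
    ∀ x : l2 m, (Summable fun i : ℕ => ‖x i‖) → Summable fun i : ℕ => ‖(Tinv x) i‖ := by
  intro x hx
  obtain ⟨c, hc⟩ := exists_norm_id_sub_smul_comp_adjoint_lt_one TG Tinv hT1
  have hG := convDominated_toeplitz hTG
  have hGs := tsum_coeffSeq_ne_top hGW
  have hGs' : ∑' d, coeffSeq G (-d) ≠ ∞ := by
    rwa [show ∑' d, coeffSeq G (-d) = ∑' d, coeffSeq G d from (Equiv.neg ℤ).tsum_eq (coeffSeq G)]
  refine summable_norm_of_eq_apply_add
    (convDominated_id.sub ((hG.comp hG.adjoint).const_smul (c : ℂ))) ?_ hc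
    (z := (c : ℂ) • x) ?_ ?_
  · rw [ENNReal.tsum_add, ENNReal.tsum_mul_left, tsum_conv]
    simp only [tsum_pi_single]
    finiteness
  · change Tinv x = Tinv x - (c : ℂ) • TG (TG.adjoint (Tinv x)) + (c : ℂ) • x
    rw [hT2, sub_add_cancel]
  · exact (hx.mul_left ‖(c : ℂ)‖).congr fun i => (norm_smul (c : ℂ) (x i)).symm
end
end

section
/- Let G ∈ W₊^{m×p} (Wiener class) with T_G T_G* strictly positive. Then for every V ∈ W₊^{(p−m)×m} the function X(z) = Y(z)Ξ₀ + Y(z)Θ₀ V(z) belongs to W₊^{p×m} and satisfies G(z) X(z) = I_m for all |z| ≤ 1; conversely, every X ∈ W₊^{p×m} satisfying G(z) X(z) = I_m on 𝔻 is of this form for some V ∈ W₊^{(p−m)×m}. -/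
/-!
Setting: `l2 n` models ℓ²₊(ℂⁿ); `lp.single 2 0` is the canonical embedding `E_n`, and
evaluating a sequence at coordinate `k` realizes `E_n* (S_n*)^k`.  Block Toeplitz and
Hankel operators, as well as the (bounded) inverse of `T_G T_G*`, are specified through
their actions on the standard basis vectors of the coordinate spaces.
-/

noncomputable section
open scoped Matrix

/-- `f` agrees on the closed unit disc with an absolutely convergent power series. -/
def IsWiener (f : ℂ → ℂ) : Prop :=
  ∃ c : ℕ → ℂ, (Summable fun ν => ‖c ν‖) ∧ ∀ z : ℂ, ‖z‖ ≤ 1 → f z = ∑' ν, z ^ ν * c ν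

lemma summable_norm_pow_mul {c : ℕ → ℂ} (hc : Summable fun ν => ‖c ν‖) {z : ℂ} (hz : ‖z‖ ≤ 1) :
    Summable fun ν => ‖z ^ ν * c ν‖ := by
  refine Summable.of_nonneg_of_le (fun _ => norm_nonneg _) (fun ν => ?_) hc
  rw [norm_mul, norm_pow]
  exact mul_le_of_le_one_left (norm_nonneg _) (pow_le_one₀ (norm_nonneg _) hz)

lemma tsum_pow_mul_mul_tsum_pow_mul {c d : ℕ → ℂ} (hc : Summable fun ν => ‖c ν‖)
    (hd : Summable fun ν => ‖d ν‖) {z : ℂ} (hz : ‖z‖ ≤ 1) :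
    (∑' ν, z ^ ν * c ν) * (∑' ν, z ^ ν * d ν) =
      ∑' n, z ^ n * ∑ kl ∈ Finset.HasAntidiagonal.antidiagonal n, c kl.1 * d kl.2 := by
  rw [tsum_mul_tsum_eq_tsum_sum_antidiagonal_of_summable_norm
    (summable_norm_pow_mul hc hz) (summable_norm_pow_mul hd hz)]
  refine tsum_congr fun n => ?_
  rw [Finset.mul_sum]
  refine Finset.sum_congr rfl fun kl hkl => ?_
  rw [← Finset.HasAntidiagonal.mem_antidiagonal.1 hkl, pow_add]
  ring

namespace IsWiener

lemma congr {f g : ℂ → ℂ} (hf : IsWiener f) (h : ∀ z, ‖z‖ ≤ 1 → g z = f z) : IsWiener g := by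
  obtain ⟨c, hc, hfc⟩ := hf
  exact ⟨c, hc, fun z hz => (h z hz).trans (hfc z hz)⟩

lemma const (a : ℂ) : IsWiener fun _ => a := by
  refine ⟨fun ν => if ν = 0 then a else 0, ?_, fun z _ => ?_⟩
  · exact summable_of_ne_finset_zero (s := {0}) fun ν hν => by simp_all
  · rw [tsum_eq_single 0 fun ν hν => by simp [hν]]
    simp

lemma add {f g : ℂ → ℂ} (hf : IsWiener f) (hg : IsWiener g) : IsWiener fun z => f z + g z := by
  obtain ⟨c, hc, hfc⟩ := hf
  obtain ⟨d, hd, hgd⟩ := hg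
  refine ⟨fun ν => c ν + d ν, (hc.add hd).of_nonneg_of_le (fun _ => norm_nonneg _)
    fun _ => norm_add_le _ _, fun z hz => ?_⟩
  beta_reduce
  rw [hfc z hz, hgd z hz, ← (summable_norm_pow_mul hc hz).of_norm.tsum_add
    (summable_norm_pow_mul hd hz).of_norm]
  exact tsum_congr fun _ => (mul_add _ _ _).symm

lemma mul {f g : ℂ → ℂ} (hf : IsWiener f) (hg : IsWiener g) : IsWiener fun z => f z * g z := by
  obtain ⟨c, hc, hfc⟩ := hf
  obtain ⟨d, hd, hgd⟩ := hg
  refine ⟨_, summable_norm_sum_mul_antidiagonal_of_summable_norm hc hd, fun z hz => ?_⟩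
  beta_reduce
  rw [hfc z hz, hgd z hz, tsum_pow_mul_mul_tsum_pow_mul hc hd hz]

lemma sum {ι : Type*} (s : Finset ι) {f : ι → ℂ → ℂ} (hf : ∀ i, IsWiener (f i)) :
    IsWiener fun z => ∑ i ∈ s, f i z := by
  classical
  induction s using Finset.induction_on with
  | empty => simpa using const 0
  | insert i s hi ih => simpa [Finset.sum_insert hi] using (hf i).add ih

lemma prod {ι : Type*} (s : Finset ι) {f : ι → ℂ → ℂ} (hf : ∀ i, IsWiener (f i)) :
    IsWiener fun z => ∏ i ∈ s, f i z := by
  classical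
  induction s using Finset.induction_on with
  | empty => simpa using const 1
  | insert i s hi ih => simpa [Finset.prod_insert hi] using (hf i).mul ih

end IsWiener

/-- The space `ℓ¹₊(ℂ)`. -/
abbrev l1 : Type := lp (fun _ : ℕ => ℂ) 1

lemma l1_summable_norm (x : l1) : Summable fun ν => ‖x ν‖ := by
  simpa using (memℓp_gen_iff (p := 1) (by simp)).1 (lp.memℓp x)

lemma l1_norm_eq (x : l1) : ‖x‖ = ∑' ν, ‖x ν‖ := by
  simpa using lp.norm_eq_tsum_rpow (p := 1) (by simp) x

/-- The forward shift of a sequence. -/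
def shiftSeq (x : ℕ → ℂ) : ℕ → ℂ
  | 0 => 0
  | n + 1 => x n

lemma summable_norm_shiftSeq {x : ℕ → ℂ} (hx : Summable fun ν => ‖x ν‖) :
    Summable fun ν => ‖shiftSeq x ν‖ :=
  (summable_nat_add_iff 1).1 hx

lemma memℓp_shiftSeq (x : l1) : Memℓp (shiftSeq x) 1 :=
  memℓp_gen <| by simpa using summable_norm_shiftSeq (l1_summable_norm x)

/-- The forward shift on `ℓ¹₊(ℂ)`. -/
def l1Shift : l1 →L[ℂ] l1 :=
  LinearMap.mkContinuous
    { toFun := fun x => ⟨shiftSeq x, memℓp_shiftSeq x⟩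
      map_add' := fun x y => by
        refine lp.ext (funext fun n => ?_)
        rcases n with _ | n
        · exact (add_zero (0 : ℂ)).symm
        · rfl
      map_smul' := fun a x => by
        refine lp.ext (funext fun n => ?_)
        rcases n with _ | n
        · exact (smul_zero a).symm
        · rfl }
    1 fun x => by
      rw [one_mul, l1_norm_eq, l1_norm_eq]
      change ∑' ν, ‖shiftSeq x ν‖ ≤ _
      rw [(summable_norm_shiftSeq (l1_summable_norm x)).tsum_eq_zero_add]
      simp [shiftSeq]

lemma l1Shift_apply (x : l1) (n : ℕ) : l1Shift x n = shiftSeq x n := rfl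

lemma norm_l1Shift_le : ‖l1Shift‖ ≤ 1 :=
  LinearMap.mkContinuous_norm_le _ zero_le_one _

/-- The functional sending a sequence to the value at `z` of its generating function. -/
def l1Eval (z : ℂ) (hz : ‖z‖ ≤ 1) : l1 →L[ℂ] ℂ :=
  LinearMap.mkContinuous
    { toFun := fun x => ∑' ν, z ^ ν * x ν
      map_add' := fun x y => by
        rw [← (summable_norm_pow_mul (l1_summable_norm x) hz).of_norm.tsum_add
          (summable_norm_pow_mul (l1_summable_norm y) hz).of_norm]
        exact tsum_congr fun _ => mul_add _ _ _
      map_smul' := fun a x => by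
        rw [RingHom.id_apply, smul_eq_mul, ← tsum_mul_left]
        exact tsum_congr fun _ => mul_left_comm _ _ _ }
    1 fun x => by
      rw [one_mul, l1_norm_eq]
      refine (norm_tsum_le_tsum_norm (summable_norm_pow_mul (l1_summable_norm x) hz)).trans ?_
      refine (summable_norm_pow_mul (l1_summable_norm x) hz).tsum_le_tsum (fun ν => ?_)
        (l1_summable_norm x)
      rw [norm_mul, norm_pow]
      exact mul_le_of_le_one_left (norm_nonneg _) (pow_le_one₀ (norm_nonneg _) hz)

lemma l1Eval_apply (z : ℂ) (hz : ‖z‖ ≤ 1) (x : l1) :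
    l1Eval z hz x = ∑' ν, z ^ ν * x ν := rfl

lemma l1Eval_shift (z : ℂ) (hz : ‖z‖ ≤ 1) (x : l1) :
    l1Eval z hz (l1Shift x) = z * l1Eval z hz x := by
  rw [l1Eval_apply, l1Eval_apply,
    (summable_norm_pow_mul (l1_summable_norm (l1Shift x)) hz).of_norm.tsum_eq_zero_add,
    ← tsum_mul_left]
  simp [l1Shift_apply, shiftSeq, pow_succ', mul_assoc]

instance : Nontrivial l1 :=
  ⟨lp.single 1 0 1, 0, fun h => by
    have := congrArg (fun x : l1 => x 0) h
    simp at this⟩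

lemma summable_smul_pow {B : Type*} [NormedRing B] [NormedAlgebra ℂ B]
    [CompleteSpace B] [NormOneClass B] {s : B} (hs : ‖s‖ ≤ 1) {c : ℕ → ℂ}
    (hc : Summable fun ν => ‖c ν‖) : Summable fun ν => c ν • s ^ ν := by
  refine Summable.of_norm (hc.of_nonneg_of_le (fun _ => norm_nonneg _) fun ν => ?_)
  rw [norm_smul]
  exact mul_le_of_le_one_right (norm_nonneg _)
    ((norm_pow_le _ _).trans (pow_le_one₀ (norm_nonneg _) hs))

lemma isUnit_tsum_smul_pow {B : Type*} [NormedCommRing B] [NormedAlgebra ℂ B]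
    [CompleteSpace B] [NormOneClass B] {s : B} (hs : ‖s‖ ≤ 1) {c : ℕ → ℂ}
    (hc : Summable fun ν => ‖c ν‖) (h : ∀ z : ℂ, ‖z‖ ≤ 1 → ∑' ν, z ^ ν * c ν ≠ 0) :
    IsUnit (∑' ν, c ν • s ^ ν) := by
  by_contra hu
  obtain ⟨φ, hφ⟩ := WeakDual.CharacterSpace.exists_apply_eq_zero hu
  have hz : ‖φ s‖ ≤ 1 :=
    (spectrum.norm_le_norm_of_mem (AlgHom.apply_mem_spectrum φ s)).trans hs
  refine h (φ s) hz ?_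
  rw [← hφ, (summable_smul_pow hs hc).map_tsum φ (map_continuous φ)]
  refine tsum_congr fun ν => ?_
  rw [map_smul, map_pow, smul_eq_mul, mul_comm]

lemma exists_inverse_tsum_smul_pow {A : Type*} [NormedRing A] [NormedAlgebra ℂ A]
    [CompleteSpace A] [NormOneClass A] {s : A} (hs : ‖s‖ ≤ 1) {c : ℕ → ℂ}
    (hc : Summable fun ν => ‖c ν‖) (h : ∀ z : ℂ, ‖z‖ ≤ 1 → ∑' ν, z ^ ν * c ν ≠ 0) :
    ∃ b : A, (∑' ν, c ν • s ^ ν) * b = 1 := by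
  let _ : NormedCommRing (Algebra.elemental ℂ s) :=
    { (inferInstance : NormedRing (Algebra.elemental ℂ s)) with
      mul_comm := fun a b => mul_comm a b }
  let s' : Algebra.elemental ℂ s := ⟨s, Algebra.elemental.self_mem ℂ s⟩
  have : NormOneClass (Algebra.elemental ℂ s) := ⟨norm_one (α := A)⟩
  obtain ⟨b, hb⟩ := (isUnit_tsum_smul_pow (s := s') hs hc h).exists_right_inv
  refine ⟨b, ?_⟩
  have h_map := (summable_smul_pow (s := s') hs hc).map_tsum
    (Algebra.elemental ℂ s).val continuous_subtype_val
  have h_coe : ((∑' ν, c ν • s' ^ ν : Algebra.elemental ℂ s) : A) = ∑' ν, c ν • s ^ ν := h_map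
  rw [← h_coe]
  exact congrArg Subtype.val hb

/-- The Wiener lemma for the analytic Wiener algebra on the closed disc. -/
lemma IsWiener.inv {f : ℂ → ℂ} (hf : IsWiener f) (h : ∀ z, ‖z‖ ≤ 1 → f z ≠ 0) :
    IsWiener fun z => (f z)⁻¹ := by
  obtain ⟨c, hc, hfc⟩ := hf
  obtain ⟨b, hb⟩ := exists_inverse_tsum_smul_pow norm_l1Shift_le hc
    fun z hz => by rw [← hfc z hz]; exact h z hz
  refine ⟨b (lp.single 1 0 1), l1_summable_norm _, fun z hz => ?_⟩
  have hpow : ∀ (ν : ℕ) (x : l1), l1Eval z hz ((l1Shift ^ ν) x) = z ^ ν * l1Eval z hz x := by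
    intro ν
    induction ν with
    | zero => simp
    | succ ν ih => intro x; rw [pow_succ, mul_apply_eq_comp, ih, l1Eval_shift]; ring
  have key : ∀ x : l1, l1Eval z hz ((∑' ν, c ν • l1Shift ^ ν) x) = f z * l1Eval z hz x := by
    intro x
    have hs := summable_smul_pow norm_l1Shift_le hc
    have h1 := hs.map_tsum
      ((l1Eval z hz).comp (ContinuousLinearMap.apply ℂ l1 x)) (ContinuousLinearMap.continuous _)
    simp only [ContinuousLinearMap.comp_apply, ContinuousLinearMap.apply_apply,
      map_smul, hpow] at h1
    rw [h1, hfc z hz, ← tsum_mul_right]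
    refine tsum_congr fun ν => ?_
    rw [smul_eq_mul]
    ring
  have h1 := key (b (lp.single 1 0 1))
  rw [← mul_apply_eq_comp, hb, one_apply_eq_self, l1Eval_apply z hz
    (lp.single 1 0 1), tsum_eq_single 0 (fun ν hν => by simp [hν])] at h1
  rw [← l1Eval_apply z hz]
  exact inv_eq_of_mul_eq_one_right (by simpa using h1.symm)

/-- A matrix function all of whose entries belong to the analytic Wiener class. -/
def IsWienerMatrix {r s : ℕ} (M : ℂ → Matrix (Fin r) (Fin s) ℂ) : Prop :=
  ∀ a b, IsWiener fun z => M z a b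

namespace IsWienerMatrix

variable {r s t : ℕ}

lemma seriesM {F : ℕ → Matrix (Fin r) (Fin s) ℂ}
    (hF : ∀ a b, Summable fun ν => ‖F ν a b‖) : IsWienerMatrix (seriesM F) :=
  fun a b => ⟨fun ν => F ν a b, hF a b, fun _ _ => rfl⟩

lemma exists_eq_seriesM {M : ℂ → Matrix (Fin r) (Fin s) ℂ} (hM : IsWienerMatrix M) :
    ∃ F : ℕ → Matrix (Fin r) (Fin s) ℂ, (∀ a b, Summable fun ν => ‖F ν a b‖) ∧
      ∀ z : ℂ, ‖z‖ ≤ 1 → _root_.seriesM F z = M z := by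
  choose c hc hMc using hM
  refine ⟨fun ν => Matrix.of fun a b => c a b ν, hc, fun z hz => ?_⟩
  ext a b
  exact (hMc a b z hz).symm

lemma const (A : Matrix (Fin r) (Fin s) ℂ) : IsWienerMatrix fun _ => A :=
  fun a b => IsWiener.const (A a b)

lemma add {M N : ℂ → Matrix (Fin r) (Fin s) ℂ} (hM : IsWienerMatrix M) (hN : IsWienerMatrix N) :
    IsWienerMatrix fun z => M z + N z :=
  fun a b => (hM a b).add (hN a b)

lemma mul {M : ℂ → Matrix (Fin r) (Fin s) ℂ} {N : ℂ → Matrix (Fin s) (Fin t) ℂ}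
    (hM : IsWienerMatrix M) (hN : IsWienerMatrix N) : IsWienerMatrix fun z => M z * N z :=
  fun a b => by
    simp only [Matrix.mul_apply]
    exact IsWiener.sum _ fun k => (hM a k).mul (hN k b)

lemma det {M : ℂ → Matrix (Fin r) (Fin r) ℂ} (hM : IsWienerMatrix M) :
    IsWiener fun z => (M z).det := by
  simp only [Matrix.det_apply']
  exact IsWiener.sum _ fun σ => (IsWiener.const _).mul (IsWiener.prod _ fun i => hM _ _)

lemma adjugate {M : ℂ → Matrix (Fin r) (Fin r) ℂ} (hM : IsWienerMatrix M) :
    IsWienerMatrix fun z => (M z).adjugate := fun a b => by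
  simp only [Matrix.adjugate_apply]
  refine IsWienerMatrix.det fun i j => ?_
  by_cases hi : i = b
  · subst hi
    simpa using IsWiener.const _
  · simpa [Matrix.updateRow_ne hi] using hM i j

lemma inv {M : ℂ → Matrix (Fin r) (Fin r) ℂ} (hM : IsWienerMatrix M)
    (h : ∀ z, ‖z‖ ≤ 1 → IsUnit (M z)) : IsWienerMatrix fun z => (M z)⁻¹ := fun a b => by
  simp only [Matrix.inv_def, Ring.inverse_eq_inv', Matrix.smul_apply, smul_eq_mul]
  exact (hM.det.inv fun z hz => ((Matrix.isUnit_iff_isUnit_det _).1 (h z hz)).ne_zero).mul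
    (hM.adjugate a b)

end IsWienerMatrix

lemma seriesM_mul_seriesM {r s t : ℕ} {A : ℕ → Matrix (Fin r) (Fin s) ℂ}
    {B : ℕ → Matrix (Fin s) (Fin t) ℂ} (hA : ∀ a b, Summable fun ν => ‖A ν a b‖)
    (hB : ∀ a b, Summable fun ν => ‖B ν a b‖) {z : ℂ} (hz : ‖z‖ ≤ 1) :
    seriesM A z * seriesM B z =
      seriesM (fun n => ∑ kl ∈ Finset.HasAntidiagonal.antidiagonal n, A kl.1 * B kl.2) z := by
  ext a b
  simp only [seriesM, Matrix.mul_apply, Matrix.of_apply, Matrix.sum_apply]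
  rw [Finset.sum_congr rfl fun k _ => tsum_pow_mul_mul_tsum_pow_mul (hA a k) (hB k b) hz,
    ← Summable.tsum_finsetSum fun k _ => (summable_norm_pow_mul
      (summable_norm_sum_mul_antidiagonal_of_summable_norm (hA a k) (hB k b)) hz).of_norm]
  refine tsum_congr fun n => ?_
  rw [← Finset.mul_sum, Finset.sum_comm]

/-- The action of a block Toeplitz operator is determined by its action on basis vectors. -/
lemma toeplitz_apply {m p : ℕ} {G : ℕ → Matrix (Fin m) (Fin p) ℂ} {TG : l2 p →L[ℂ] l2 m}
    (hTG : ∀ (j : ℕ) (b : Fin p) (i : ℕ) (a : Fin m),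
      (TG (lp.single 2 j (eVec p b))) i a = if j ≤ i then G (i - j) a b else 0)
    (x : l2 p) (i : ℕ) (a : Fin m) :
    (TG x) i a = ∑ kl ∈ Finset.HasAntidiagonal.antidiagonal i, ∑ b, G kl.1 a b * x kl.2 b := by
  let φ : l2 p →L[ℂ] ℂ :=
    (EuclideanSpace.proj a).comp ((lp.evalCLM ℂ (fun _ : ℕ => ES m) 2 i).comp TG)
  have hφ : ∀ y, φ y = (TG y) i a := fun _ => rfl
  have hsingle : ∀ j (v : ES p), φ (lp.single 2 j v) =
      if j ≤ i then ∑ b, G (i - j) a b * v b else 0 := by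
    intro j v
    have hv : lp.single 2 j v = ∑ b, v b • (lp.single 2 j (eVec p b) : l2 p) := by
      conv_lhs => rw [← (EuclideanSpace.basisFun (Fin p) ℂ).sum_repr v]
      rw [← lp.singleContinuousLinearMap_apply (𝕜 := ℂ), map_sum]
      simp
    rw [hv, map_sum]
    simp only [map_smul]
    simp only [hφ, hTG, smul_eq_mul]
    split_ifs
    · exact Finset.sum_congr rfl fun _ _ => mul_comm _ _
    · simp
  have hs := (lp.hasSum_single (p := 2) (by simp) x).mapL φ
  rw [← hφ, ← hs.tsum_eq, tsum_eq_sum (s := Finset.range (i + 1))]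
  · rw [← Finset.Nat.sum_antidiagonal_swap,
      Finset.Nat.sum_antidiagonal_eq_sum_range_succ_mk]
    refine Finset.sum_congr rfl fun j hj => ?_
    rw [hsingle, if_pos (Nat.lt_succ_iff.1 (Finset.mem_range.1 hj))]
    rfl
  · intro j hj
    rw [hsingle, if_neg (by simpa using hj)]

/-- If `A` has a right inverse and the columns of the injective `B` lie in the kernel of `A` with
complementary dimension, then they span it. -/
lemma exists_matrix_mul_mul_eq {m p : ℕ} (hmp : m ≤ p) {A : Matrix (Fin m) (Fin p) ℂ}
    {B : Matrix (Fin p) (Fin (p - m)) ℂ} {R : Matrix (Fin p) (Fin m) ℂ} (hR : A * R = 1)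
    (hAB : A * B = 0) (hB : ∀ w : Fin (p - m) → ℂ, B.mulVec w = 0 → w = 0) :
    ∃ L : Matrix (Fin (p - m)) (Fin p) ℂ, ∀ {t : ℕ} (W : Matrix (Fin p) (Fin t) ℂ),
      A * W = 0 → B * (L * W) = W := by
  have hker : LinearMap.ker B.mulVecLin = ⊥ := LinearMap.ker_eq_bot'.2 hB
  obtain ⟨l, hl⟩ := LinearMap.exists_leftInverse_of_injective _ hker
  have hsurj : LinearMap.range A.mulVecLin = ⊤ := LinearMap.range_eq_top.2 fun y =>
    ⟨R.mulVec y, by simp [Matrix.mulVec_mulVec, hR]⟩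
  have hrange : LinearMap.range B.mulVecLin = LinearMap.ker A.mulVecLin := by
    refine Submodule.eq_of_le_of_finrank_eq ?_ ?_
    · rintro _ ⟨w, rfl⟩
      simp [Matrix.mulVec_mulVec, hAB]
    · rw [LinearMap.finrank_range_of_inj (LinearMap.ker_eq_bot.1 hker)]
      have h := A.mulVecLin.finrank_range_add_finrank_ker
      rw [hsurj] at h
      simp only [finrank_top, Module.finrank_fin_fun] at h ⊢
      omega
  refine ⟨LinearMap.toMatrix' l, fun {t} W hW => ?_⟩
  refine Matrix.ext_of_mulVec_single fun k => ?_
  have hmem : W.mulVec (Pi.single k 1) ∈ LinearMap.range B.mulVecLin := by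
    rw [hrange]
    rw [LinearMap.mem_ker, Matrix.mulVecLin_apply, Matrix.mulVec_mulVec, hW, Matrix.zero_mulVec]
  obtain ⟨v, hv⟩ := hmem
  rw [← Matrix.mulVec_mulVec, ← Matrix.mulVec_mulVec, ← hv, LinearMap.toMatrix'_mulVec,
    ← LinearMap.comp_apply, hl]
  rfl

/-- For `G ∈ W₊^{m×p}` with `T_G T_G*` strictly positive: for every
`V ∈ W₊^{(p−m)×m}` the function `X(z) = Y(z)Ξ₀ + Y(z)Θ₀V(z)` belongs to `W₊^{p×m}` and
solves `G(z)X(z) = I_m` on the closed disc; conversely every Wiener solution of the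
Bezout equation arises this way. (Wiener-class functions are represented by their
absolutely summable coefficient sequences via `seriesM`.) -/
theorem bezout_corona_stmt13
    (m p : ℕ) (hm : 0 < m) (hmp : m ≤ p)
    (G : ℕ → Matrix (Fin m) (Fin p) ℂ)
    (hGW : ∀ (a : Fin m) (b : Fin p), Summable fun ν => ‖G ν a b‖)
    (TG : l2 p →L[ℂ] l2 m)
    (hTG : ∀ (j : ℕ) (b : Fin p) (i : ℕ) (a : Fin m),
      (TG (lp.single 2 j (eVec p b))) i a = if j ≤ i then G (i - j) a b else 0)
    (HG : l2 p →L[ℂ] l2 m)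
    (hHG : ∀ (j : ℕ) (b : Fin p) (i : ℕ) (a : Fin m),
      (HG (lp.single 2 j (eVec p b))) i a = G (i + j + 1) a b)
    (Tinv : l2 m →L[ℂ] l2 m)
    (hT1 : ∀ x, Tinv (TG (TG.adjoint x)) = x)
    (hT2 : ∀ x, TG (TG.adjoint (Tinv x)) = x)
    (Ξ₀ : Matrix (Fin p) (Fin m) ℂ)
    (hΞ₀ : ∀ (a : Fin p) (b : Fin m),
      Ξ₀ a b = (TG.adjoint (Tinv (lp.single 2 0 (eVec m b)))) 0 a)
    (Θ₀ : Matrix (Fin p) (Fin (p - m)) ℂ)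
    (hΘ₀ker : ∀ w : Fin (p - m) → ℂ, Θ₀.mulVec w = 0 → w = 0)
    (hΘ₀ : ∀ (a b : Fin p), (Θ₀ * Θ₀ᴴ) a b
      = (if a = b then 1 else 0) - (TG.adjoint (Tinv (TG (lp.single 2 0 (eVec p b))))) 0 a)
    (Yc : ℕ → Matrix (Fin p) (Fin p) ℂ)
    (hYc0 : Yc 0 = 1)
    (hYc : ∀ (ν : ℕ) (a b : Fin p),
      Yc (ν + 1) a b = -(TG.adjoint (Tinv (HG (lp.single 2 0 (eVec p b))))) ν a)
    (hYcW : ∀ a b, Summable fun ν => ‖Yc ν a b‖)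
    (hYunit : ∀ z : ℂ, ‖z‖ ≤ 1 → IsUnit (seriesM Yc z)) :
    (∀ Vc : ℕ → Matrix (Fin (p - m)) (Fin m) ℂ,
      (∀ a b, Summable fun ν => ‖Vc ν a b‖) →
      (∃ Xc : ℕ → Matrix (Fin p) (Fin m) ℂ,
        (∀ a b, Summable fun ν => ‖Xc ν a b‖) ∧
        ∀ z : ℂ, ‖z‖ ≤ 1 →
          seriesM Xc z = seriesM Yc z * Ξ₀ + seriesM Yc z * Θ₀ * seriesM Vc z) ∧
      (∀ z : ℂ, ‖z‖ ≤ 1 →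
        seriesM G z * (seriesM Yc z * Ξ₀ + seriesM Yc z * Θ₀ * seriesM Vc z) = 1)) ∧
    (∀ Xc : ℕ → Matrix (Fin p) (Fin m) ℂ,
      (∀ a b, Summable fun ν => ‖Xc ν a b‖) →
      (∀ z ∈ Metric.ball (0 : ℂ) 1, seriesM G z * seriesM Xc z = 1) →
      ∃ Vc : ℕ → Matrix (Fin (p - m)) (Fin m) ℂ,
        (∀ a b, Summable fun ν => ‖Vc ν a b‖) ∧
        ∀ z ∈ Metric.ball (0 : ℂ) 1,
          seriesM Xc z = seriesM Yc z * Ξ₀ + seriesM Yc z * Θ₀ * seriesM Vc z) := by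
  have hGy : ∀ (x : l2 p) (a : Fin m),
      ∑ b, G 0 a b * x 0 b = (TG x) 0 a := fun x a => by
    rw [toeplitz_apply hTG]
    simp
  have hG0Ξ : G 0 * Ξ₀ = 1 := by
    ext a b
    simp only [Matrix.mul_apply, hΞ₀]
    rw [hGy, hT2, lp.single_apply_self, Matrix.one_apply]
    simp
  have hG0Θ : G 0 * Θ₀ = 0 := by
    have h : G 0 * (Θ₀ * Θ₀ᴴ) = 0 := by
      ext a b
      simp only [Matrix.mul_apply (M := G 0), hΘ₀, mul_sub, Finset.sum_sub_distrib]
      rw [hGy, hT2, hTG]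
      simp
    open scoped ComplexOrder in
    rw [← Matrix.self_mul_conjTranspose_eq_zero, Matrix.conjTranspose_mul, ← Matrix.mul_assoc,
      Matrix.mul_assoc (G 0), h, Matrix.zero_mul]
  have hGY : ∀ z : ℂ, ‖z‖ ≤ 1 → seriesM G z * seriesM Yc z = G 0 := by
    intro z hz
    rw [seriesM_mul_seriesM hGW hYcW hz]
    ext a b
    simp only [seriesM, Matrix.of_apply]
    rw [tsum_eq_single 0]
    · simp [hYc0]
    · rintro (_ | n) hn
      · exact absurd rfl hn
      · rw [Finset.Nat.sum_antidiagonal_succ']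
        simp only [hYc0, Matrix.mul_one, Matrix.add_apply, Matrix.sum_apply]
        simp only [Matrix.mul_apply, hYc, mul_neg, Finset.sum_neg_distrib]
        rw [← toeplitz_apply hTG, hT2, hHG]
        simp
  have hYW : IsWienerMatrix (seriesM Yc) := .seriesM hYcW
  have hΞW : IsWienerMatrix fun z => seriesM Yc z * Ξ₀ := hYW.mul (.const Ξ₀)
  refine ⟨fun Vc hVc => ⟨?_, fun z hz => ?_⟩, fun Xc hXc hX => ?_⟩
  · exact (hΞW.add ((hYW.mul (.const Θ₀)).mul (.seriesM hVc))).exists_eq_seriesM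
  · rw [Matrix.mul_add, ← Matrix.mul_assoc, ← Matrix.mul_assoc, ← Matrix.mul_assoc, hGY z hz,
      hG0Ξ, hG0Θ, Matrix.zero_mul, add_zero]
  · obtain ⟨L, hL⟩ := exists_matrix_mul_mul_eq hmp hG0Ξ hG0Θ hΘ₀ker
    obtain ⟨Vc, hVc, hV⟩ := ((IsWienerMatrix.const L).mul
      (((hYW.inv hYunit).mul (.seriesM hXc)).add (.const (-Ξ₀)))).exists_eq_seriesM
    refine ⟨Vc, hVc, fun z hz => ?_⟩
    have hz1 : ‖z‖ ≤ 1 := (mem_ball_zero_iff.1 hz).le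
    have hdet := (Matrix.isUnit_iff_isUnit_det _).1 (hYunit z hz1)
    have hG0W : G 0 * ((seriesM Yc z)⁻¹ * seriesM Xc z + -Ξ₀) = 0 := by
      rw [Matrix.mul_add, Matrix.mul_neg, hG0Ξ, ← hGY z hz1, Matrix.mul_assoc,
        Matrix.mul_nonsing_inv_cancel_left _ _ hdet, hX z hz, add_neg_cancel]
    rw [hV z hz1, Matrix.mul_assoc, hL _ hG0W, Matrix.mul_add,
      Matrix.mul_nonsing_inv_cancel_left _ _ hdet, Matrix.mul_neg]
    abel
end
end
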